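/- arXiv:1708.05041 — 2 statements merged into one kernel-verified Lean document; each statement's English description precedes it below -/
import Mathlib

section
/- If G is a connected, claw-free, cubic graph of order n that is not isomorphic to K_4, then F_t(G) ≤ n/2. -/
/-- A set `T` of (colored) vertices is closed under the forcing rule: whenever a colored
vertex `v ∈ T` has the property that all of its neighbors outside `T` are equal to `w`
(i.e. `w` is its unique non-colored neighbor, if `w ∉ T`), then `w ∈ T`. -/
def ForcingClosed {V : Type*} (G : SimpleGraph V) (T : Set V) : Prop :=
  ∀ v ∈ T, ∀ w, G.Adj v w → (∀ u, G.Adj v u → u ∉ T → u = w) → w ∈ T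

/-- `S` is a (zero) forcing set of `G`: iterating the forcing process starting from `S`
colors all vertices; equivalently, every forcing-closed superset of `S` is everything. -/
def IsForcingSet {V : Type*} (G : SimpleGraph V) (S : Set V) : Prop :=
  ∀ T : Set V, S ⊆ T → ForcingClosed G T → ∀ v, v ∈ T

/-- `S` is a total forcing set of `G`: a forcing set whose induced subgraph has no
isolated vertex. -/
def IsTotalForcingSet {V : Type*} (G : SimpleGraph V) (S : Set V) : Prop :=
  IsForcingSet G S ∧ ∀ v ∈ S, ∃ w ∈ S, G.Adj v w

/-- The forcing number `F(G)`: minimum cardinality of a forcing set. -/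
noncomputable def forcingNumber {V : Type*} (G : SimpleGraph V) : ℕ :=
  sInf {n : ℕ | ∃ S : Set V, IsForcingSet G S ∧ S.ncard = n}

/-- The total forcing number `F_t(G)`: minimum cardinality of a total forcing set. -/
noncomputable def totalForcingNumber {V : Type*} (G : SimpleGraph V) : ℕ :=
  sInf {n : ℕ | ∃ S : Set V, IsTotalForcingSet G S ∧ S.ncard = n}

/-- `G` is cubic (3-regular): every vertex has exactly 3 neighbors. -/
def IsCubic {V : Type*} (G : SimpleGraph V) : Prop := ∀ v, (G.neighborSet v).ncard = 3

/-- `G` is claw-free: it has no induced `K_{1,3}`. -/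
def ClawFree {V : Type*} (G : SimpleGraph V) : Prop :=
  ¬ ∃ v a b c : V, G.Adj v a ∧ G.Adj v b ∧ G.Adj v c ∧
    a ≠ b ∧ a ≠ c ∧ b ≠ c ∧ ¬ G.Adj a b ∧ ¬ G.Adj a c ∧ ¬ G.Adj b c

/-- The abstract greedy argument on a cubic multigraph of triangles. -/
theorem abstract_greedy {V : Type*} [DecidableEq V] (W : Finset V) (tri : V → Finset V)
    (m : V → V) (hne : W.Nonempty)
    (hself : ∀ p ∈ W, p ∈ tri p) (hsub : ∀ p ∈ W, tri p ⊆ W)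
    (hcard : ∀ p ∈ W, (tri p).card = 3) (heq : ∀ p ∈ W, ∀ q ∈ tri p, tri q = tri p)
    (hmW : ∀ p ∈ W, m p ∈ W) (hmm : ∀ p ∈ W, m (m p) = p) (hmne : ∀ p ∈ W, m p ≠ p)
    (hconn : ∀ X : Finset V, X ⊆ W → X.Nonempty → (∀ p ∈ X, tri p ⊆ X) →
      (∀ p ∈ X, m p ∈ X) → X = W) :
    ∃ S : Finset V, S ⊆ W ∧ 2 * S.card ≤ W.card ∧
      (∀ p ∈ S, (∃ q ∈ S, q ≠ p ∧ q ∈ tri p) ∨ m p ∈ tri p) ∧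
      ∀ X Y : Set V, (∀ p ∈ S, p ∈ X) →
        (∀ p ∈ W, ∀ q ∈ tri p, p ≠ q → p ∈ X → q ∈ X → p ∈ Y → ∀ r ∈ tri p, r ∈ X) →
        (∀ p ∈ W, (∀ r ∈ tri p, r ∈ X) → m p ∈ X ∧ m p ∈ Y) →
        (∀ p ∈ S, m p ∈ tri p → m p ∉ S → p ∈ Y) → ∀ p ∈ W, p ∈ X := by
  classical
  -- the main extension claim
  have key : ∀ n : ℕ, ∀ S T : Finset V, (W \ T).card = n → S ⊆ T → T ⊆ W → T.Nonempty →
      (∀ p ∈ T, tri p ⊆ T) →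
      2 * S.card ≤ T.card + (T.filter (fun p => m p ∉ T)).card →
      (∀ p ∈ S, (∃ q ∈ S, q ≠ p ∧ q ∈ tri p) ∨ m p ∈ tri p) →
      (∀ X Y : Set V, (∀ p ∈ S, p ∈ X) →
        (∀ p ∈ W, ∀ q ∈ tri p, p ≠ q → p ∈ X → q ∈ X → p ∈ Y → ∀ r ∈ tri p, r ∈ X) →
        (∀ p ∈ W, (∀ r ∈ tri p, r ∈ X) → m p ∈ X ∧ m p ∈ Y) →
        (∀ p ∈ S, m p ∈ tri p → m p ∉ S → p ∈ Y) → ∀ p ∈ T, p ∈ X) →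
      ∃ S : Finset V, S ⊆ W ∧ 2 * S.card ≤ W.card ∧
        (∀ p ∈ S, (∃ q ∈ S, q ≠ p ∧ q ∈ tri p) ∨ m p ∈ tri p) ∧
        ∀ X Y : Set V, (∀ p ∈ S, p ∈ X) →
          (∀ p ∈ W, ∀ q ∈ tri p, p ≠ q → p ∈ X → q ∈ X → p ∈ Y → ∀ r ∈ tri p, r ∈ X) →
          (∀ p ∈ W, (∀ r ∈ tri p, r ∈ X) → m p ∈ X ∧ m p ∈ Y) →
          (∀ p ∈ S, m p ∈ tri p → m p ∉ S → p ∈ Y) → ∀ p ∈ W, p ∈ X := by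
    intro n
    induction n using Nat.strong_induction_on with
    | _ n ih =>
    intro S T hn hST hTW hTne hTtri hbud htot hforce
    by_cases hTm : ∀ p ∈ T, m p ∈ T
    · have hTeq := hconn T hTW hTne hTtri hTm
      subst hTeq
      refine ⟨S, hST, ?_, htot, hforce⟩
      have : T.filter (fun p => m p ∉ T) = ∅ := by
        apply Finset.filter_eq_empty_iff.2
        intro p hp; simpa using hTm p hp
      rw [this] at hbud
      simpa using hbud
    · push Not at hTm
      obtain ⟨p, hpT, hmpT⟩ := hTm
      have hpW := hTW hpT
      have hwW := hmW p hpW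
      obtain ⟨w, hw⟩ : ∃ w, w = m p := ⟨_, rfl⟩
      rw [← hw] at hwW hmpT
      have hmw : m w = p := by rw [hw]; exact hmm p hpW
      -- names for the triangle
      obtain ⟨a, b, hwa, hwb, hab, htriw⟩ : ∃ a b, w ≠ a ∧ w ≠ b ∧ a ≠ b ∧ tri w = {w, a, b} := by
        have h1 : ((tri w).erase w).card = 2 := by
          rw [Finset.card_erase_of_mem (hself w hwW), hcard w hwW]
        obtain ⟨a, b, hab, h2⟩ := Finset.card_eq_two.1 h1
        have ha : a ∈ (tri w).erase w := by rw [h2]; simp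
        have hb : b ∈ (tri w).erase w := by rw [h2]; simp
        refine ⟨a, b, (Finset.ne_of_mem_erase ha).symm, (Finset.ne_of_mem_erase hb).symm, hab, ?_⟩
        rw [← Finset.insert_erase (hself w hwW), h2]
      have haW : a ∈ W := hsub w hwW (by rw [htriw]; simp)
      have hbW : b ∈ W := hsub w hwW (by rw [htriw]; simp)
      have htria : tri a = {w, a, b} := by rw [heq w hwW a (by rw [htriw]; simp), htriw]
      have htrib : tri b = {w, a, b} := by rw [heq w hwW b (by rw [htriw]; simp), htriw]
      have haT : a ∉ T := fun h => hmpT (hTtri a h (by rw [htria]; simp))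
      have hbT : b ∉ T := fun h => hmpT (hTtri b h (by rw [htrib]; simp))
      -- symmetric extension step
      have step : ∀ S' : Finset V, S ⊆ S' → S' ⊆ S ∪ {w, a, b} →
          2 * S'.card ≤ T.card + 3 +
            ((T ∪ {w, a, b}).filter (fun p => m p ∉ T ∪ {w, a, b})).card →
          (∀ p ∈ S', p ∉ S → (∃ q ∈ S', q ≠ p ∧ q ∈ tri p) ∨ m p ∈ tri p) →
          (∀ X Y : Set V, (∀ p ∈ S', p ∈ X) → (∀ p ∈ T, p ∈ X) → w ∈ X → w ∈ Y →
            (∀ p ∈ W, ∀ q ∈ tri p, p ≠ q → p ∈ X → q ∈ X → p ∈ Y → ∀ r ∈ tri p, r ∈ X) →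
            (∀ p ∈ W, (∀ r ∈ tri p, r ∈ X) → m p ∈ X ∧ m p ∈ Y) →
            a ∈ X ∨ b ∈ X) →
          ∃ S : Finset V, S ⊆ W ∧ 2 * S.card ≤ W.card ∧
            (∀ p ∈ S, (∃ q ∈ S, q ≠ p ∧ q ∈ tri p) ∨ m p ∈ tri p) ∧
            ∀ X Y : Set V, (∀ p ∈ S, p ∈ X) →
              (∀ p ∈ W, ∀ q ∈ tri p, p ≠ q → p ∈ X → q ∈ X → p ∈ Y → ∀ r ∈ tri p, r ∈ X) →
              (∀ p ∈ W, (∀ r ∈ tri p, r ∈ X) → m p ∈ X ∧ m p ∈ Y) →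
              (∀ p ∈ S, m p ∈ tri p → m p ∉ S → p ∈ Y) → ∀ p ∈ W, p ∈ X := by
        intro S' hSS' hS'sub hb' htot' hf'
        have hlt : (W \ (T ∪ {w, a, b})).card < n := by
          rw [← hn]
          apply Finset.card_lt_card
          refine ⟨?_, ?_⟩
          · intro z; simp; tauto
          · intro h
            have := h (Finset.mem_sdiff.2 ⟨hwW, hmpT⟩)
            simp at this
        have hcT : (T ∪ {w, a, b}).card = T.card + 3 := by
          rw [Finset.card_union_of_disjoint]
          · congr 1
            rw [← htriw]; exact hcard w hwW
          · simp [hmpT, haT, hbT]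
        refine ih _ hlt S' (T ∪ {w, a, b}) rfl ?_ ?_ ?_ ?_ ?_ ?_ ?_
        · intro z hz
          have := hS'sub hz
          simp only [Finset.mem_union] at this ⊢
          rcases this with h | h
          · exact Or.inl (hST h)
          · exact Or.inr h
        · intro z; simp only [Finset.mem_union, Finset.mem_insert, Finset.mem_singleton]
          rintro (h | rfl | rfl | rfl)
          · exact hTW h
          all_goals assumption
        · exact hTne.mono Finset.subset_union_left
        · intro z hz
          simp only [Finset.mem_union, Finset.mem_insert, Finset.mem_singleton] at hz
          rcases hz with h | rfl | rfl | rfl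
          · exact (hTtri z h).trans Finset.subset_union_left
          · rw [htriw]; exact Finset.subset_union_right
          · rw [htria]; exact Finset.subset_union_right
          · rw [htrib]; exact Finset.subset_union_right
        · rw [hcT]; exact hb'
        · intro z hz
          by_cases hzS : z ∈ S
          · rcases htot z hzS with ⟨q, hq, h⟩ | h
            · exact Or.inl ⟨q, hSS' hq, h⟩
            · exact Or.inr h
          · exact htot' z hz hzS
        · intro X Y h1 h2 h3 h4
          have hT := hforce X Y (fun p hp => h1 p (hSS' hp)) h2 h3
            (fun p hp hm hmS => h4 p (hSS' hp) hm (fun hm' => by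
              have g1 : m p ∈ T := hTtri p (hST hp) hm
              have g2 := hS'sub hm'
              simp only [Finset.mem_union, Finset.mem_insert, Finset.mem_singleton] at g2
              rcases g2 with g2 | g2 | g2 | g2
              · exact hmS g2
              · exact hmpT (g2 ▸ g1)
              · exact haT (g2 ▸ g1)
              · exact hbT (g2 ▸ g1)))
          have hw1 := h3 p hpW (fun r hr => hT r (hTtri p hpT hr))
          rw [← hw] at hw1
          have h5 := hf' X Y h1 hT hw1.1 hw1.2 h2 h3
          have h6 : ∀ r ∈ tri w, r ∈ X := by
            rcases h5 with h | h
            · exact h2 w hwW a (by rw [htriw]; simp) hwa hw1.1 h hw1.2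
            · exact h2 w hwW b (by rw [htriw]; simp) hwb hw1.1 h hw1.2
          intro z hz
          rcases Finset.mem_union.1 hz with h | h
          · exact hT z h
          · exact h6 z (by rw [htriw]; exact h)
      have hpmem : p ∈ T.filter (fun p => m p ∉ T) := by
        simp [hpT, ← hw, hmpT]
      have hmaW := hmW a haW
      have hmbW := hmW b hbW
      have hmma := hmm a haW
      have hmmb := hmm b hbW
      have hmnea := hmne a haW
      have hmneb := hmne b hbW
      have hmaw : m a ≠ w := by
        intro h; rw [h, hmw] at hmma; exact haT (hmma ▸ hpT)
      have hmbw : m b ≠ w := by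
        intro h; rw [h, hmw] at hmmb; exact hbT (hmmb ▸ hpT)
      by_cases hcase : m a ∈ T ∨ m b ∈ T
      · refine step S (Finset.Subset.refl _) Finset.subset_union_left ?_ ?_ ?_
        · have hsub' : T.filter (fun p => m p ∉ T) ⊆
              (T ∪ {w, a, b}).filter (fun p => m p ∉ T ∪ {w, a, b}) ∪ {m w, m a, m b} := by
            intro z hz
            simp only [Finset.mem_filter] at hz
            have hmz := hmm z (hTW hz.1)
            simp only [Finset.mem_union, Finset.mem_filter, Finset.mem_insert,
              Finset.mem_singleton]
            by_cases h1 : m z = w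
            · right; left; rw [← h1, hmz]
            by_cases h2 : m z = a
            · right; right; left; rw [← h2, hmz]
            by_cases h3 : m z = b
            · right; right; right; rw [← h3, hmz]
            left; exact ⟨Or.inl hz.1, by tauto⟩
          have h1 := Finset.card_le_card hsub'
          have h2 := Finset.card_union_le
            ((T ∪ {w, a, b}).filter (fun p => m p ∉ T ∪ {w, a, b})) {m w, m a, m b}
          have h3 : ({m w, m a, m b} : Finset V).card ≤ 3 := Finset.card_le_three
          omega
        · intro z h1 h2; exact absurd h1 h2
        · intro X Y h1 h2 h3 h4 h5 h6
          rcases hcase with h | h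
          · left
            have := (h6 (m a) hmaW (fun r hr => h2 r (hTtri _ h hr))).1
            rwa [hmma] at this
          · right
            have := (h6 (m b) hmbW (fun r hr => h2 r (hTtri _ h hr))).1
            rwa [hmmb] at this
      · push Not at hcase
        obtain ⟨hmaT, hmbT⟩ := hcase
        have hers : (T.filter (fun p => m p ∉ T)).erase p ⊆
              (T ∪ {w, a, b}).filter (fun p => m p ∉ T ∪ {w, a, b}) := by
          intro z hz
          simp only [Finset.mem_erase, Finset.mem_filter] at hz
          obtain ⟨hzp, hzT, hmzT⟩ := hz
          have hmz := hmm z (hTW hzT)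
          simp only [Finset.mem_union, Finset.mem_filter, Finset.mem_insert,
              Finset.mem_singleton]
          refine ⟨Or.inl hzT, ?_⟩
          rintro (h | h | h | h)
          · exact hmzT h
          · rw [h, hmw] at hmz; exact hzp hmz.symm
          · rw [h] at hmz; exact hmaT (hmz ▸ hzT)
          · rw [h] at hmz; exact hmbT (hmz ▸ hzT)
        have hcers := Finset.card_erase_of_mem hpmem
        have hcpos : 0 < (T.filter (fun p => m p ∉ T)).card := Finset.card_pos.2 ⟨p, hpmem⟩
        by_cases hloop : m a = b
        · refine step (insert a S) (Finset.subset_insert _ _) ?_ ?_ ?_ ?_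
          · intro z; simp; tauto
          · have h1 := Finset.card_le_card hers
            have h2 := Finset.card_insert_le a S
            omega
          · intro z hz hzS
            have : z = a := by simpa [hzS] using hz
            subst this
            right; rw [hloop, htria]; simp
          · intro X Y h1 _ _ _ _ _
            exact Or.inl (h1 a (by simp))
        · have hmba : m b ≠ a := by
            intro h; rw [h] at hmmb; exact hloop hmmb
          refine step (insert w (insert a S)) ?_ ?_ ?_ ?_ ?_
          · intro z; simp; tauto
          · intro z; simp; tauto
          · have hers2 : insert a (insert b ((T.filter (fun p => m p ∉ T)).erase p)) ⊆
              (T ∪ {w, a, b}).filter (fun p => m p ∉ T ∪ {w, a, b}) := by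
              intro z hz
              rcases Finset.mem_insert.1 hz with rfl | hz
              · simp [hmaT, hmaw, hmnea, hloop]
              rcases Finset.mem_insert.1 hz with rfl | hz
              · simp [hmbT, hmbw, hmneb, hmba]
              exact hers hz
            have h1 := Finset.card_le_card hers2
            have h2 := Finset.card_insert_le a S
            have h3 := Finset.card_insert_le w (insert a S)
            rw [Finset.card_insert_of_notMem (by simp [hab, haT]),
              Finset.card_insert_of_notMem (by simp [hbT])] at h1
            omega
          · intro z hz hzS
            have hz' : z = w ∨ z = a := by simpa [hzS] using hz
            rcases hz' with rfl | rfl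
            · exact Or.inl ⟨a, by simp, hwa.symm, by rw [htriw]; simp⟩
            · exact Or.inl ⟨w, by simp, hwa, by rw [htria]; simp⟩
          · intro X Y h1 _ _ _ _ _
            exact Or.inl (h1 a (by simp))
  obtain ⟨p, hpW⟩ := hne
  by_cases hl : ∃ q ∈ tri p, m q ∈ tri p
  · obtain ⟨q, hq, hmq⟩ := hl
    have hqW := hsub p hpW hq
    have htq := heq p hpW q hq
    rw [← htq] at hmq
    have hmmq := hmm q hqW
    have hmqne := hmne q hqW
    have hc : (((tri q).erase q).erase (m q)).card = 1 := by
      rw [Finset.card_erase_of_mem (by simp [hmq, hmqne]),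
        Finset.card_erase_of_mem (hself q hqW), hcard q hqW]
    obtain ⟨r, hr⟩ := Finset.card_eq_one.1 hc
    have hr' : r ∈ ((tri q).erase q).erase (m q) := by rw [hr]; simp
    simp only [Finset.mem_erase] at hr'
    obtain ⟨hr1, hr2, hr3⟩ := hr'
    have htr : ∀ z ∈ tri q, z = q ∨ z = m q ∨ z = r := by
      intro z hz
      by_contra hcon
      push Not at hcon
      have : z ∈ ((tri q).erase q).erase (m q) := by simp [hz, hcon]
      rw [hr] at this
      simp at this; tauto
    have hrW := hsub q hqW hr3
    have htrr := heq q hqW r hr3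
    have hmmr := hmm r hrW
    refine key _ {q, r} (tri q) rfl ?_ (hsub q hqW) ⟨q, hself q hqW⟩ ?_ ?_ ?_ ?_
    · intro z; simp only [Finset.mem_insert, Finset.mem_singleton]
      rintro (rfl | rfl)
      · exact hself _ hqW
      · exact hr3
    · intro z hz; rw [heq q hqW z hz]
    · have h1 : r ∈ (tri q).filter (fun p => m p ∉ tri q) := by
        simp only [Finset.mem_filter]
        refine ⟨hr3, fun h => ?_⟩
        rcases htr _ h with h | h | h
        · rw [h] at hmmr; exact hr1 hmmr.symm
        · rw [h, hmmq] at hmmr; exact hr2 hmmr.symm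
        · exact hmne r hrW h
      have h2 : 0 < ((tri q).filter (fun p => m p ∉ tri q)).card := Finset.card_pos.2 ⟨r, h1⟩
      have h3 : ({q, r} : Finset V).card ≤ 2 := Finset.card_le_two
      have h4 := hcard q hqW
      omega
    · intro z hz
      simp only [Finset.mem_insert, Finset.mem_singleton] at hz
      rcases hz with rfl | rfl
      · exact Or.inr hmq
      · refine Or.inl ⟨q, by simp, hr2.symm, ?_⟩
        rw [htrr]; exact hself q hqW
    · intro X Y h1 h2 h3 h4
      exact h2 q hqW r hr3 hr2.symm (h1 q (by simp)) (h1 r (by simp)) (h4 q (by simp) hmq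
        (by simp [hmqne, hr1.symm]))
  · push Not at hl
    refine key _ (tri p) (tri p) rfl (Finset.Subset.refl _) (hsub p hpW) ⟨p, hself p hpW⟩ ?_ ?_ ?_ ?_
    · intro z hz; rw [heq p hpW z hz]
    · rw [Finset.filter_true_of_mem hl]; omega
    · intro z hz
      left
      rw [heq p hpW z hz]
      have : 1 < (tri p).card := by rw [hcard p hpW]; norm_num
      obtain ⟨q, hq, hne⟩ := Finset.exists_mem_ne this z
      exact ⟨q, hq, hne, hq⟩
    · intro X Y h1 _ _ _
      exact h1

/-- First return map of the "wire" permutation. -/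
theorem wire_map {V : Type*} [Fintype V] (E W : V → Prop) (s d : V → V)
    (hs : ∀ v, s (s v) = v) (hd : ∀ v, d (d v) = v)
    (hsE : ∀ v, E v → E (s v)) (hdE : ∀ v, E v → E (d v))
    (hsne : ∀ v, E v → s v ≠ v) (hdW : ∀ v, W v → d v = v)
    (hWd : ∀ v, E v → d v = v → W v) (hWE : ∀ v, W v → E v) :
    ∃ m : V → V, (∀ p, W p → W (m p)) ∧ (∀ p, W p → m (m p) = p) ∧ (∀ p, W p → m p ≠ p) ∧
      (∀ R : V → Prop, (∀ v, E v → R v → R (s v)) → (∀ v, E v → R v → R (d v)) →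
        ∀ p, W p → R p → R (m p)) ∧
      (∀ p, W p → W (s p) → m p = s p) ∧
      (∀ p, W p → ¬ W (s p) → W (s (d (s p))) → m p = s (d (s p))) ∧
      (∀ X : V → Prop, (∀ p, X p → W p) → (∀ p, X p → X (m p)) →
        ∃ Z : V → Prop, (∀ v, Z v → E v) ∧ (∀ v, Z v → Z (s v)) ∧ (∀ v, Z v → Z (d v)) ∧
          ∀ w, W w → (Z w ↔ X w)) := by
  classical
  let t : Equiv.Perm V := ⟨fun v => s (d v), fun v => d (s v), fun v => by simp [hs, hd],
    fun v => by simp [hs, hd]⟩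
  have ht : ∀ v, t v = s (d v) := fun v => rfl
  have htE : ∀ v, E v → E (t v) := fun v h => hsE _ (hdE _ h)
  have htEn : ∀ n : ℕ, ∀ v, E v → E ((t ^ n) v) := by
    intro n
    induction n with
    | zero => intro v h; simpa using h
    | succ n ih => intro v h; rw [pow_succ']; exact htE _ (ih v h)
  -- reversal
  have hrev : ∀ n : ℕ, ∀ v, (t ^ n) (d ((t ^ n) v)) = d v := by
    intro n
    induction n with
    | zero => intro v; simp
    | succ n ih =>
      intro v
      have h1 : ∀ z, (t ^ (n + 1)) z = t ((t ^ n) z) := fun z => by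
        rw [pow_succ', Equiv.Perm.mul_apply]
      have h2 : (t ^ (n + 1)) v = (t ^ n) (t v) := by rw [pow_succ, Equiv.Perm.mul_apply]
      rw [h1, h2, ih, ht, ht, hd, hs]
  have hex : ∀ p, W p → ∃ k : ℕ, 0 < k ∧ W ((t ^ k) p) := by
    intro p hp
    exact ⟨orderOf t, orderOf_pos t, by rw [pow_orderOf_eq_one]; simpa using hp⟩
  let k : V → ℕ := fun p => if h : W p then Nat.find (hex p h) else 0
  have hk : ∀ p, W p → 0 < k p ∧ W ((t ^ (k p)) p) := by
    intro p hp
    simp only [k, dif_pos hp]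
    exact Nat.find_spec (hex p hp)
  have hkmin : ∀ p, W p → ∀ n, 0 < n → W ((t ^ n) p) → k p ≤ n := by
    intro p hp n h1 h2
    simp only [k, dif_pos hp]
    exact Nat.find_min' (hex p hp) ⟨h1, h2⟩
  have hback : ∀ p q, W p → W q → ∀ n : ℕ, (t ^ n) p = q → (t ^ n) q = p := by
    intro p q hp hq n h
    have := hrev n p
    rw [h, hdW q hq, hdW p hp] at this
    exact this
  refine ⟨fun p => (t ^ (k p)) p, fun p hp => (hk p hp).2, ?_, ?_, ?_, ?_, ?_, ?_⟩
  · intro p hp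
    have h1 := hk p hp
    have h2 := hback p _ hp h1.2 _ rfl
    have h3 := hkmin _ h1.2 (k p) h1.1 (by rw [h2]; exact hp)
    have h4 := hk _ h1.2
    have h5 := hback _ _ h1.2 h4.2 _ rfl
    obtain ⟨q, hq⟩ : ∃ q, q = (t ^ (k p)) p := ⟨_, rfl⟩
    simp only [← hq] at h1 h2 h3 h4 h5 ⊢
    rcases h3.lt_or_eq with hlt | he
    · exfalso
      obtain ⟨r, hr⟩ : ∃ r, r = (t ^ (k q)) q := ⟨_, rfl⟩
      simp only [← hr] at h4 h5
      have h6 : (t ^ (k q)) ((t ^ (k p - k q)) p) = (t ^ (k q)) r := by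
        rw [h5, ← Equiv.Perm.mul_apply, ← pow_add, Nat.add_sub_cancel' h3, ← hq]
      have h7 := (t ^ (k q)).injective h6
      have h8 := hkmin p hp (k p - k q) (by omega) (by rw [h7]; exact h4.2)
      omega
    · rw [he, h2]
  · intro p hp heq
    obtain ⟨h1, h2⟩ := hk p hp
    simp only at heq
    rcases Nat.even_or_odd' (k p) with ⟨l, hl | hl⟩
    · have hr := hrev l p
      rw [hdW p hp] at hr
      have h3 : (t ^ l) ((t ^ l) p) = p := by
        rw [← Equiv.Perm.mul_apply, ← pow_add, ← two_mul, ← hl]; exact heq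
      have h4 := (t ^ l).injective (hr.trans h3.symm)
      have h5 := hkmin p hp l (by omega) (hWd _ (htEn l p (hWE p hp)) h4)
      omega
    · have hr := hrev l p
      rw [hdW p hp] at hr
      have h3 : (t ^ l) (t ((t ^ l) p)) = p := by
        rw [← Equiv.Perm.mul_apply, ← Equiv.Perm.mul_apply, ← pow_succ, ← pow_add]
        rw [show l + 1 + l = k p by omega]; exact heq
      have h4 := (t ^ l).injective (hr.trans h3.symm)
      rw [ht] at h4
      exact hsne _ (hdE _ (htEn l p (hWE p hp))) h4.symm
  · intro R hRs hRd p hp hR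
    have : ∀ n : ℕ, R ((t ^ n) p) := by
      intro n
      induction n with
      | zero => simpa using hR
      | succ n ih =>
        rw [pow_succ']
        exact hRs _ (hdE _ (htEn n p (hWE p hp))) (hRd _ (htEn n p (hWE p hp)) ih)
    exact this _
  · intro p hp h
    have ht1 : (t ^ 1) p = s p := by rw [pow_one, ht, hdW p hp]
    have h1 := hkmin p hp 1 one_pos (by rw [ht1]; exact h)
    have h2 := (hk p hp).1
    have : k p = 1 := by omega
    simp only [this, ht1]
  · intro p hp hn h
    have ht1 : (t ^ 1) p = s p := by rw [pow_one, ht, hdW p hp]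
    have ht2 : (t ^ 2) p = s (d (s p)) := by
      rw [pow_succ', Equiv.Perm.mul_apply, ht1, ht]
    have h1 := hkmin p hp 2 two_pos (by rw [ht2]; exact h)
    have h2 := (hk p hp)
    have h3 : k p ≠ 1 := by
      intro h3; rw [h3, ht1] at h2; exact hn h2.2
    have : k p = 2 := by omega
    simp only [this, ht2]
  · intro X hXW hXm
    have hX : ∀ n : ℕ, ∀ p, X p → W ((t ^ n) p) → X ((t ^ n) p) := by
      intro n
      induction n using Nat.strong_induction_on with
      | _ n ih =>
      intro p hp hw
      rcases Nat.eq_zero_or_pos n with rfl | hpos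
      · simpa using hp
      have h1 := hkmin p (hXW p hp) n hpos hw
      have h2 := (hk p (hXW p hp)).1
      have h3 : (t ^ n) p = (t ^ (n - k p)) ((t ^ (k p)) p) := by
        rw [← Equiv.Perm.mul_apply, ← pow_add, Nat.sub_add_cancel h1]
      rw [h3] at hw ⊢
      exact ih _ (by omega) _ (hXm p hp) hw
    have hZd : ∀ p, X p → ∀ n : ℕ, ∃ j : ℕ, d ((t ^ n) p) = (t ^ j) p := by
      intro p hp n
      have hr := hrev n p
      rw [hdW p (hXW p hp)] at hr
      have : t.SameCycle p (d ((t ^ n) p)) := by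
        refine Equiv.Perm.SameCycle.symm ⟨(n : ℤ), ?_⟩
        simpa using hr
      obtain ⟨j, -, -, hj⟩ := this.exists_pow_eq
      exact ⟨j, hj.symm⟩
    refine ⟨fun v => ∃ p, X p ∧ ∃ n : ℕ, v = (t ^ n) p, ?_, ?_, ?_, ?_⟩
    · rintro v ⟨p, hp, n, rfl⟩
      exact htEn n p (hWE p (hXW p hp))
    · rintro v ⟨p, hp, n, rfl⟩
      obtain ⟨j, hj⟩ := hZd p hp n
      refine ⟨p, hp, j + 1, ?_⟩
      rw [pow_succ', Equiv.Perm.mul_apply, ← hj, ht, hd]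
    · rintro v ⟨p, hp, n, rfl⟩
      obtain ⟨j, hj⟩ := hZd p hp n
      exact ⟨p, hp, j, hj⟩
    · intro w hw
      constructor
      · rintro ⟨p, hp, n, rfl⟩
        exact hX n p hp hw
      · intro h
        exact ⟨w, h, 0, by simp⟩

theorem closed_univ {V : Type*} {G : SimpleGraph V} (hconn : G.Connected) (U : V → Prop) (v0 : V)
    (h0 : U v0) (h : ∀ v w, G.Adj v w → U v → U w) : ∀ v, U v := by
  intro v
  obtain ⟨p⟩ := hconn.preconnected v0 v
  induction p with
  | nil => exact h0
  | cons hadj _ ih => exact ih (h _ _ hadj h0)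

/-- Labelling of the neighbours of each vertex. -/
structure Loc {V : Type*} (G : SimpleGraph V) (a b c : V → V) : Prop where
  adj : ∀ v u, G.Adj v u ↔ u = a v ∨ u = b v ∨ u = c v
  ab : ∀ v, a v ≠ b v
  ac : ∀ v, a v ≠ c v
  bc : ∀ v, b v ≠ c v
  hab : ∀ v, G.Adj (a v) (b v)
  hac : ∀ v, ¬ G.Adj (a v) (c v)

theorem iso_K4 {V : Type*} [Fintype V] {G : SimpleGraph V} (hconn : G.Connected)
    (hcubic : IsCubic G) (v x y z : V) (hN : G.neighborSet v = {x, y, z})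
    (hxy : x ≠ y) (hxz : x ≠ z) (hyz : y ≠ z)
    (h1 : G.Adj x y) (h2 : G.Adj x z) (h3 : G.Adj y z) :
    Nonempty (G ≃g (⊤ : SimpleGraph (Fin 4))) := by
  classical
  have hv : ∀ u, G.Adj v u ↔ u = x ∨ u = y ∨ u = z := by
    intro u
    have : u ∈ G.neighborSet v ↔ u ∈ ({x, y, z} : Set V) := by rw [hN]
    simpa using this
  have hvx : G.Adj v x := (hv x).2 (by simp)
  have hvy : G.Adj v y := (hv y).2 (by simp)
  have hvz : G.Adj v z := (hv z).2 (by simp)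
  have full : ∀ p q r s : V, q ≠ r → q ≠ s → r ≠ s → G.Adj p q → G.Adj p r → G.Adj p s →
      ∀ u, G.Adj p u → u = q ∨ u = r ∨ u = s := by
    intro p q r s hqr hqs hrs hq hr hs u hu
    have hsub : ({q, r, s} : Set V) ⊆ G.neighborSet p := by
      rintro w (rfl | rfl | rfl) <;> assumption
    have hc : ({q, r, s} : Set V).ncard = 3 := Set.ncard_eq_three.2 ⟨q, r, s, hqr, hqs, hrs, rfl⟩
    have := Set.eq_of_subset_of_ncard_le hsub (by rw [hc, hcubic p]) (Set.toFinite _)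
    have hu' : u ∈ ({q, r, s} : Set V) := by rw [this]; exact hu
    simpa using hu'
  have hall : ∀ u, u = v ∨ u = x ∨ u = y ∨ u = z := by
    apply closed_univ hconn (fun u => u = v ∨ u = x ∨ u = y ∨ u = z) v (by simp)
    intro p q hpq hp
    rcases hp with rfl | rfl | rfl | rfl
    · exact Or.inr ((hv q).1 hpq)
    · have := full p v y z hvy.ne hvz.ne hyz hvx.symm h1 h2 q hpq; tauto
    · have := full p v x z hvx.ne hvz.ne hxz hvy.symm h1.symm h3 q hpq; tauto
    · have := full p v x y hvx.ne hvy.ne hxy hvz.symm h2.symm h3.symm q hpq; tauto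
  have htop : G = ⊤ := by
    ext p q
    rw [SimpleGraph.top_adj]
    refine ⟨fun h => h.ne, fun h => ?_⟩
    have hp := hall p
    have hq := hall q
    rcases hp with rfl | rfl | rfl | rfl <;> rcases hq with rfl | rfl | rfl | rfl <;>
      first
        | exact absurd rfl h
        | assumption
        | (apply SimpleGraph.Adj.symm; assumption)
  have hcard : Fintype.card V = 4 := by
    have hu : (Finset.univ : Finset V) = {v, x, y, z} := by
      ext u; simpa using hall u
    rw [← Finset.card_univ, hu]
    rw [Finset.card_insert_of_notMem (by simp [hvx.ne, hvy.ne, hvz.ne]),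
      Finset.card_insert_of_notMem (by simp [hxy, hxz]),
      Finset.card_insert_of_notMem (by simp [hyz])]
    simp
  subst htop
  exact ⟨SimpleGraph.Iso.completeGraph (Fintype.equivFinOfCardEq hcard)⟩

theorem exists_loc {V : Type*} [Fintype V]
    (G : SimpleGraph V) (hconn : G.Connected) (hcf : ClawFree G) (hcubic : IsCubic G)
    (hK4 : ¬ Nonempty (G ≃g (⊤ : SimpleGraph (Fin 4)))) : ∃ a b c : V → V, Loc G a b c := by
  have : ∀ v, ∃ a b c : V, (∀ u, G.Adj v u ↔ u = a ∨ u = b ∨ u = c) ∧ a ≠ b ∧ a ≠ c ∧ b ≠ c ∧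
      G.Adj a b ∧ ¬ G.Adj a c := by
    intro v
    obtain ⟨x, y, z, hxy, hxz, hyz, hN⟩ := Set.ncard_eq_three.1 (hcubic v)
    have hv : ∀ u, G.Adj v u ↔ u = x ∨ u = y ∨ u = z := by
      intro u
      have : u ∈ G.neighborSet v ↔ u ∈ ({x, y, z} : Set V) := by rw [hN]
      simpa using this
    have hnot : ¬ (G.Adj x y ∧ G.Adj x z ∧ G.Adj y z) := fun ⟨h1, h2, h3⟩ =>
      hK4 (iso_K4 hconn hcubic v x y z hN hxy hxz hyz h1 h2 h3)
    have hsome : G.Adj x y ∨ G.Adj x z ∨ G.Adj y z := by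
      by_contra hcon
      push Not at hcon
      exact hcf ⟨v, x, y, z, (hv x).2 (by simp), (hv y).2 (by simp), (hv z).2 (by simp),
        hxy, hxz, hyz, hcon.1, hcon.2.1, hcon.2.2⟩
    by_cases h1 : G.Adj x y
    · by_cases h2 : G.Adj x z
      · exact ⟨y, x, z, fun u => by rw [hv]; tauto, hxy.symm, hyz, hxz, h1.symm, by tauto⟩
      · exact ⟨x, y, z, hv, hxy, hxz, hyz, h1, h2⟩
    · by_cases h2 : G.Adj x z
      · exact ⟨x, z, y, fun u => by rw [hv]; tauto, hxz, hxy, hyz.symm, h2, h1⟩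
      · exact ⟨y, z, x, fun u => by rw [hv]; tauto, hyz, hxy.symm, hxz.symm, by tauto,
          fun h => h1 h.symm⟩
  choose a b c h using this
  exact ⟨a, b, c, fun v => (h v).1, fun v => (h v).2.1, fun v => (h v).2.2.1,
    fun v => (h v).2.2.2.1, fun v => (h v).2.2.2.2.1, fun v => (h v).2.2.2.2.2⟩

namespace Loc

variable {V : Type*} {G : SimpleGraph V} {a b c : V → V}

theorem va (h : Loc G a b c) (v : V) : G.Adj v (a v) := (h.adj v _).2 (Or.inl rfl)
theorem vb (h : Loc G a b c) (v : V) : G.Adj v (b v) := (h.adj v _).2 (Or.inr (Or.inl rfl))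
theorem vc (h : Loc G a b c) (v : V) : G.Adj v (c v) := (h.adj v _).2 (Or.inr (Or.inr rfl))

/-- In an `E`-vertex the only adjacent pair of neighbours is `a, b`. -/
theorem pairE (h : Loc G a b c) {u x y : V} (hE : ¬ G.Adj (b u) (c u)) (hx : G.Adj u x)
    (hy : G.Adj u y) (hxy : G.Adj x y) : (x = a u ∧ y = b u) ∨ (x = b u ∧ y = a u) := by
  have h1 := h.hac u
  have h2 := hxy.ne
  rcases (h.adj u x).1 hx with rfl | rfl | rfl <;> rcases (h.adj u y).1 hy with rfl | rfl | rfl <;>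
    simp_all [SimpleGraph.adj_comm]

theorem pairT (h : Loc G a b c) {u x y : V} (hx : G.Adj u x)
    (hy : G.Adj u y) (hxy : G.Adj x y) : x = b u ∨ y = b u := by
  have h1 := h.hac u
  have h2 := hxy.ne
  rcases (h.adj u x).1 hx with rfl | rfl | rfl <;> rcases (h.adj u y).1 hy with rfl | rfl | rfl <;>
    simp_all [SimpleGraph.adj_comm]

theorem s_spec (h : Loc G a b c) {v : V} (hE : ¬ G.Adj (b v) (c v)) :
    c (c v) = v ∧ ¬ G.Adj (b (c v)) (c (c v)) := by
  have key : ∀ x, G.Adj (c v) x → ¬ G.Adj v x := by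
    intro x hx hvx
    rcases h.pairE hE hvx (h.vc v) hx.symm with ⟨_, h2⟩ | ⟨_, h2⟩
    · exact h.bc v h2.symm
    · exact h.ac v h2.symm
  have h1 : c (c v) = v := by
    rcases (h.adj (c v) v).1 (h.vc v).symm with h1 | h1 | h1
    · have := h.hab (c v)
      rw [← h1] at this
      exact absurd this (key _ (h.vb _))
    · have := h.hab (c v)
      rw [← h1] at this
      exact absurd this.symm (key _ (h.va _))
    · exact h1.symm
  refine ⟨h1, ?_⟩
  rw [h1]
  exact fun h2 => key _ (h.vb _) h2.symm

/-- The partner of a twin. -/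
theorem t_spec (h : Loc G a b c) {t : V} (hT : G.Adj (b t) (c t)) :
    b (b t) = t ∧ G.Adj (b (b t)) (c (b t)) ∧
      ((a (b t) = a t ∧ c (b t) = c t) ∨ (a (b t) = c t ∧ c (b t) = a t)) := by
  have h1 := (h.adj (b t) t).1 (h.vb t).symm
  have h2 := (h.adj (b t) (a t)).1 (h.hab t).symm
  have h3 := (h.adj (b t) (c t)).1 hT
  have h4 : t = b (b t) := by
    rcases h.pairT (h.vb t).symm (h.hab t).symm (h.va t) with h5 | h5
    · exact h5
    · rcases h.pairT (h.vb t).symm hT (h.vc t) with h6 | h6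
      · exact h6
      · exact absurd (h5.trans h6.symm) (h.ac t)
  have h5 := h.ac t
  have h6 := (h.va t).ne
  have h7 := (h.vc t).ne
  have h8 : (a (b t) = a t ∧ c (b t) = c t) ∨ (a (b t) = c t ∧ c (b t) = a t) := by
    rw [← h4] at h2 h3
    rcases h2 with h2 | h2 | h2
    · rcases h3 with h3 | h3 | h3
      · exact absurd (h2.trans h3.symm) h5
      · exact absurd h3.symm h7
      · exact Or.inl ⟨h2.symm, h3.symm⟩
    · exact absurd h2.symm h6
    · rcases h3 with h3 | h3 | h3
      · exact Or.inr ⟨h3.symm, h2.symm⟩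
      · exact absurd h3.symm h7
      · exact absurd (h2.trans h3.symm) h5
  refine ⟨h4.symm, ?_, h8⟩
  rw [← h4]
  rcases h8 with h8 | h8
  · rw [h8.2]; exact h.vc t
  · rw [h8.2]; exact h.va t

/-- Ends of a diamond. -/
theorem ta_spec (h : Loc G a b c) {t : V} (hT : G.Adj (b t) (c t)) :
    ¬ G.Adj (b (a t)) (c (a t)) ∧
      ((a (a t) = t ∧ b (a t) = b t) ∨ (a (a t) = b t ∧ b (a t) = t)) := by
  obtain ⟨h1, h2, h3⟩ := h.t_spec hT
  have hE : ¬ G.Adj (b (a t)) (c (a t)) := by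
    intro hE
    -- `t` or `b t` would be the partner of `a t`
    obtain ⟨g1, g2, g3⟩ := h.t_spec hE
    rcases h.pairT (h.va t).symm (h.hab t) (h.vb t) with h5 | h5
    · have := g1
      rw [← h5] at this
      exact h.ab t this.symm
    · have g4 : b (b t) = a t := by rw [h5]; exact g1
      rw [h1] at g4
      exact (h.va t).ne g4
  refine ⟨hE, ?_⟩
  rcases h.pairE hE (h.va t).symm (h.hab t) (h.vb t) with ⟨h5, h6⟩ | ⟨h5, h6⟩
  · exact Or.inl ⟨h5.symm, h6.symm⟩
  · exact Or.inr ⟨h6.symm, h5.symm⟩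

theorem tc_spec (h : Loc G a b c) {t : V} (hT : G.Adj (b t) (c t)) :
    ¬ G.Adj (b (c t)) (c (c t)) ∧
      ((a (c t) = t ∧ b (c t) = b t) ∨ (a (c t) = b t ∧ b (c t) = t)) := by
  obtain ⟨h1, h2, h3⟩ := h.t_spec hT
  have hE : ¬ G.Adj (b (c t)) (c (c t)) := by
    intro hE
    obtain ⟨g1, g2, g3⟩ := h.t_spec hE
    rcases h.pairT (h.vc t).symm hT.symm (h.vb t) with h5 | h5
    · have := g1
      rw [← h5] at this
      exact h.bc t this
    · have g4 : b (b t) = c t := by rw [h5]; exact g1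
      rw [h1] at g4
      exact (h.vc t).ne g4
  refine ⟨hE, ?_⟩
  rcases h.pairE hE (h.vc t).symm hT.symm (h.vb t) with ⟨h5, h6⟩ | ⟨h5, h6⟩
  · exact Or.inl ⟨h5.symm, h6.symm⟩
  · exact Or.inr ⟨h6.symm, h5.symm⟩

theorem end_spec (h : Loc G a b c) {v : V} (hE : ¬ G.Adj (b v) (c v))
    (hT : G.Adj (b (a v)) (c (a v))) :
    b (a v) = b v ∧ G.Adj (b (b v)) (c (b v)) ∧ (a (a v) = v ∨ c (a v) = v) := by
  have h1 : b (a v) = b v := by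
    rcases h.pairT (h.va v).symm (h.hab v) (h.vb v) with h5 | h5
    · have := h.t_spec hT
      rw [← h5] at this
      exact absurd this.2.1 hE
    · exact h5.symm
  obtain ⟨g1, g2, g3⟩ := h.t_spec hT
  rw [h1] at g1 g2
  refine ⟨h1, g2, ?_⟩
  rcases (h.adj (a v) v).1 (h.va v).symm with h5 | h5 | h5
  · exact Or.inl h5.symm
  · rw [h1] at h5; exact absurd h5 (h.vb v).ne
  · exact Or.inr h5.symm

theorem end_spec' (h : Loc G a b c) {v : V} (hE : ¬ G.Adj (b v) (c v))
    (hT : G.Adj (b (b v)) (c (b v))) : G.Adj (b (a v)) (c (a v)) := by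
  have h1 : b (b v) = a v := by
    rcases h.pairT (h.vb v).symm (h.hab v).symm (h.va v) with h5 | h5
    · have := h.t_spec hT
      rw [← h5] at this
      exact absurd this.2.1 hE
    · exact h5.symm
  have := (h.t_spec hT).2.1
  rwa [h1] at this

/-- Triangle units. -/
theorem tri_spec (h : Loc G a b c) {v : V} (ha : ¬ G.Adj (b (a v)) (c (a v))) 
    (hb : ¬ G.Adj (b (b v)) (c (b v))) :
    ((a (a v) = v ∧ b (a v) = b v) ∨ (a (a v) = b v ∧ b (a v) = v)) ∧
    ((a (b v) = v ∧ b (b v) = a v) ∨ (a (b v) = a v ∧ b (b v) = v)) := by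
  constructor
  · rcases h.pairE ha (h.va v).symm (h.hab v) (h.vb v) with ⟨h5, h6⟩ | ⟨h5, h6⟩
    · exact Or.inl ⟨h5.symm, h6.symm⟩
    · exact Or.inr ⟨h6.symm, h5.symm⟩
  · rcases h.pairE hb (h.vb v).symm (h.hab v).symm (h.va v) with ⟨h5, h6⟩ | ⟨h5, h6⟩
    · exact Or.inl ⟨h5.symm, h6.symm⟩
    · exact Or.inr ⟨h6.symm, h5.symm⟩

end Loc

/-- Vertices lying in exactly one triangle. -/
def LE' {V : Type*} (G : SimpleGraph V) (b c : V → V) (v : V) : Prop := ¬ G.Adj (b v) (c v)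

/-- Vertices of triangle units. -/
def LW {V : Type*} (G : SimpleGraph V) (a b c : V → V) (v : V) : Prop :=
  LE' G b c v ∧ LE' G b c (a v) ∧ LE' G b c (b v)

open Classical in
/-- Outer partner. -/
noncomputable def Ls {V : Type*} (G : SimpleGraph V) (b c : V → V) (v : V) : V :=
  if LE' G b c v then c v else v

open Classical in
/-- Opposite end in a diamond. -/
noncomputable def Ld {V : Type*} (G : SimpleGraph V) (a b c : V → V) (v : V) : V :=
  if LE' G b c v ∧ ¬ LW G a b c v then (if a (a v) = v then c (a v) else a (a v)) else v

namespace Loc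

variable {V : Type*} {G : SimpleGraph V} {a b c : V → V}

theorem twin_of_end (h : Loc G a b c) {v : V} (hE : LE' G b c v) (hW : ¬ LW G a b c v) :
    ¬ LE' G b c (a v) := by
  intro ha
  apply hW
  refine ⟨hE, ha, fun hb => ha (h.end_spec' hE hb)⟩

/-- Every end is `a t` or `c t` for the twin `t = a v`. -/
theorem end_eq (h : Loc G a b c) {v : V} (hE : LE' G b c v) (hW : ¬ LW G a b c v) :
    ∃ t, G.Adj (b t) (c t) ∧ (v = a t ∨ v = c t) := by
  have hT := not_not.1 (h.twin_of_end hE hW)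
  refine ⟨a v, hT, ?_⟩
  rcases (h.end_spec hE hT).2.2 with h1 | h1
  · exact Or.inl h1.symm
  · exact Or.inr h1.symm

theorem notW_a (h : Loc G a b c) {t : V} (hT : G.Adj (b t) (c t)) : ¬ LW G a b c (a t) := by
  rintro ⟨h1, h2, h3⟩
  rcases (h.ta_spec hT).2 with h4 | h4
  · rw [h4.1] at h2; exact h2 hT
  · rw [h4.2] at h3; exact h3 hT

theorem notW_c (h : Loc G a b c) {t : V} (hT : G.Adj (b t) (c t)) : ¬ LW G a b c (c t) := by
  rintro ⟨h1, h2, h3⟩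
  rcases (h.tc_spec hT).2 with h4 | h4
  · rw [h4.1] at h2; exact h2 hT
  · rw [h4.2] at h3; exact h3 hT

theorem d_a (h : Loc G a b c) {t : V} (hT : G.Adj (b t) (c t)) : Ld G a b c (a t) = c t := by
  have h1 := h.ta_spec hT
  have h3 := (h.t_spec hT).2.2
  have hac := h.ac t
  rw [Ld, if_pos ⟨h1.1, h.notW_a hT⟩]
  rcases h1.2 with h4 | h4
  · rw [h4.1, if_pos rfl]
  · rw [h4.1]
    rcases h3 with h5 | h5
    · rw [if_pos h5.1, h5.2]
    · rw [if_neg (by rw [h5.1]; exact hac.symm), h5.1]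

theorem d_c (h : Loc G a b c) {t : V} (hT : G.Adj (b t) (c t)) : Ld G a b c (c t) = a t := by
  have h1 := h.tc_spec hT
  have h3 := (h.t_spec hT).2.2
  have hac := h.ac t
  rw [Ld, if_pos ⟨h1.1, h.notW_c hT⟩]
  rcases h1.2 with h4 | h4
  · rw [h4.1, if_neg hac]
  · rw [h4.1]
    rcases h3 with h5 | h5
    · rw [if_neg (by rw [h5.1]; exact hac), h5.1]
    · rw [if_pos h5.1, h5.2]

theorem d_W {v : V} (hW : LW G a b c v) : Ld G a b c v = v := by
  rw [Ld, if_neg (fun h => h.2 hW)]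

theorem d_T {v : V} (hT : ¬ LE' G b c v) : Ld G a b c v = v := by
  rw [Ld, if_neg (fun h => hT h.1)]

theorem d_d (h : Loc G a b c) (v : V) : Ld G a b c (Ld G a b c v) = v := by
  by_cases hE : LE' G b c v
  · by_cases hW : LW G a b c v
    · rw [d_W hW, d_W hW]
    · obtain ⟨t, hT, rfl | rfl⟩ := h.end_eq hE hW
      · rw [h.d_a hT, h.d_c hT]
      · rw [h.d_c hT, h.d_a hT]
  · rw [d_T hE, d_T hE]

theorem d_E (h : Loc G a b c) (v : V) (hE : LE' G b c v) : LE' G b c (Ld G a b c v) := by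
  by_cases hW : LW G a b c v
  · rwa [d_W hW]
  · obtain ⟨t, hT, rfl | rfl⟩ := h.end_eq hE hW
    · rw [h.d_a hT]; exact (h.tc_spec hT).1
    · rw [h.d_c hT]; exact (h.ta_spec hT).1

theorem d_fix (h : Loc G a b c) (v : V) (hE : LE' G b c v) (hd : Ld G a b c v = v) :
    LW G a b c v := by
  by_contra hW
  obtain ⟨t, hT, rfl | rfl⟩ := h.end_eq hE hW
  · rw [h.d_a hT] at hd; exact h.ac t hd.symm
  · rw [h.d_c hT] at hd; exact h.ac t hd

theorem d_nadj (h : Loc G a b c) {v : V} (hE : LE' G b c v) : Ld G a b c v ≠ c v := by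
  intro hd
  by_cases hW : LW G a b c v
  · rw [d_W hW] at hd; exact (h.vc v).ne hd
  obtain ⟨t, hT, rfl | rfl⟩ := h.end_eq hE hW
  · rw [h.d_a hT] at hd
    exact h.hac t (hd ▸ h.vc (a t))
  · rw [h.d_c hT] at hd
    have := h.vc (c t)
    rw [← hd] at this
    exact h.hac t this.symm

theorem s_E {v : V} (hE : LE' G b c v) : Ls G b c v = c v := by
  rw [Ls, if_pos hE]

theorem s_s (h : Loc G a b c) (v : V) : Ls G b c (Ls G b c v) = v := by
  by_cases hE : LE' G b c v
  · rw [s_E hE, s_E (h.s_spec hE).2]; exact (h.s_spec hE).1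
  · rw [Ls, Ls, if_neg hE, if_neg hE]

theorem W_a (h : Loc G a b c) {v : V} (hW : LW G a b c v) : LW G a b c (a v) := by
  obtain ⟨h1, h2, h3⟩ := hW
  refine ⟨h2, ?_⟩
  rcases (h.tri_spec h2 h3).1 with h4 | h4
  · rw [h4.1, h4.2]; exact ⟨h1, h3⟩
  · rw [h4.1, h4.2]; exact ⟨h3, h1⟩

theorem W_b (h : Loc G a b c) {v : V} (hW : LW G a b c v) : LW G a b c (b v) := by
  obtain ⟨h1, h2, h3⟩ := hW
  refine ⟨h3, ?_⟩
  rcases (h.tri_spec h2 h3).2 with h4 | h4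
  · rw [h4.1, h4.2]; exact ⟨h1, h2⟩
  · rw [h4.1, h4.2]; exact ⟨h2, h1⟩

/-! Forcing lemmas. -/

theorem force_a (h : Loc G a b c) {T : Set V} (hT : ForcingClosed G T) {v : V} (hv : v ∈ T)
    (h1 : b v ∈ T) (h2 : c v ∈ T) : a v ∈ T := by
  refine hT v hv _ (h.va v) (fun u hu hn => ?_)
  rcases (h.adj v u).1 hu with rfl | rfl | rfl
  · rfl
  · exact absurd h1 hn
  · exact absurd h2 hn

theorem force_b (h : Loc G a b c) {T : Set V} (hT : ForcingClosed G T) {v : V} (hv : v ∈ T)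
    (h1 : a v ∈ T) (h2 : c v ∈ T) : b v ∈ T := by
  refine hT v hv _ (h.vb v) (fun u hu hn => ?_)
  rcases (h.adj v u).1 hu with rfl | rfl | rfl
  · exact absurd h1 hn
  · rfl
  · exact absurd h2 hn

theorem force_c (h : Loc G a b c) {T : Set V} (hT : ForcingClosed G T) {v : V} (hv : v ∈ T)
    (h1 : a v ∈ T) (h2 : b v ∈ T) : c v ∈ T := by
  refine hT v hv _ (h.vc v) (fun u hu hn => ?_)
  rcases (h.adj v u).1 hu with rfl | rfl | rfl
  · exact absurd h1 hn
  · exact absurd h2 hn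
  · rfl

theorem full_end (h : Loc G a b c) {T : Set V} (hT : ForcingClosed G T)
    (hA : ∀ t, G.Adj (b t) (c t) → t ∈ T ∨ b t ∈ T) {x : V} (hE : LE' G b c x)
    (hW : ¬ LW G a b c x) (hx : x ∈ T) (hcx : c x ∈ T) : a x ∈ T ∧ b x ∈ T := by
  have h1 := not_not.1 (h.twin_of_end hE hW)
  have h2 := (h.end_spec hE h1).1
  rcases hA _ h1 with h3 | h3
  · exact ⟨h3, h.force_b hT hx h3 hcx⟩
  · rw [h2] at h3
    exact ⟨h.force_a hT hx h3 hcx, h3⟩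

theorem trans_end (h : Loc G a b c) {T : Set V} (hT : ForcingClosed G T)
    (hA : ∀ t, G.Adj (b t) (c t) → t ∈ T ∨ b t ∈ T) {x : V} (hE : LE' G b c x)
    (hx : x ∈ T) (hcx : c x ∈ T) : Ld G a b c x ∈ T ∧ c (Ld G a b c x) ∈ T := by
  by_cases hW : LW G a b c x
  · rw [d_W hW]; exact ⟨hx, hcx⟩
  have hf := h.full_end hT hA hE hW hx hcx
  obtain ⟨t, hTw, rfl | rfl⟩ := h.end_eq hE hW
  · rw [h.d_a hTw]
    have h1 := (h.ta_spec hTw).2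
    have h2 : t ∈ T ∧ b t ∈ T := by
      rcases h1 with h1 | h1
      · rw [h1.1, h1.2] at hf; exact hf
      · rw [h1.1, h1.2] at hf; exact hf.symm
    have h3 := h.force_c hT h2.1 hx h2.2
    refine ⟨h3, h.force_c hT h3 ?_ ?_⟩
    · rcases (h.tc_spec hTw).2 with h4 | h4
      · rw [h4.1]; exact h2.1
      · rw [h4.1]; exact h2.2
    · rcases (h.tc_spec hTw).2 with h4 | h4
      · rw [h4.2]; exact h2.2
      · rw [h4.2]; exact h2.1
  · rw [h.d_c hTw]
    have h1 := (h.tc_spec hTw).2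
    have h2 : t ∈ T ∧ b t ∈ T := by
      rcases h1 with h1 | h1
      · rw [h1.1, h1.2] at hf; exact hf
      · rw [h1.1, h1.2] at hf; exact hf.symm
    have h3 := h.force_a hT h2.1 h2.2 hx
    refine ⟨h3, h.force_c hT h3 ?_ ?_⟩
    · rcases (h.ta_spec hTw).2 with h4 | h4
      · rw [h4.1]; exact h2.1
      · rw [h4.1]; exact h2.2
    · rcases (h.ta_spec hTw).2 with h4 | h4
      · rw [h4.2]; exact h2.2
      · rw [h4.2]; exact h2.1

theorem final_force (h : Loc G a b c) (hconn : G.Connected) {T : Set V} (hT : ForcingClosed G T)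
    (hA : ∀ t, G.Adj (b t) (c t) → t ∈ T ∨ b t ∈ T) (hW : ∀ v, LW G a b c v → v ∈ T)
    (v0 : V) (h0 : v0 ∈ T) (hE0 : LE' G b c v0) (hc0 : c v0 ∈ T) : ∀ v, v ∈ T := by
  have hR : ∀ v, LE' G b c v → v ∈ T → c v ∈ T → a v ∈ T ∧ b v ∈ T := by
    intro v hE h1 h2
    by_cases hw : LW G a b c v
    · exact ⟨hW _ (h.W_a hw), hW _ (h.W_b hw)⟩
    · exact h.full_end hT hA hE hw h1 h2
  have hall := closed_univ hconn (fun v => v ∈ T ∧ a v ∈ T ∧ b v ∈ T ∧ c v ∈ T) v0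
    ⟨h0, (hR v0 hE0 h0 hc0).1, (hR v0 hE0 h0 hc0).2, hc0⟩ (by
    rintro v w hvw ⟨hv, hav, hbv, hcv⟩
    -- an `E`-vertex with its three triangle vertices coloured is fine
    have hin : ∀ w, LE' G b c w → w ∈ T → a w ∈ T → b w ∈ T →
        w ∈ T ∧ a w ∈ T ∧ b w ∈ T ∧ c w ∈ T := fun w _ h1 h2 h3 =>
      ⟨h1, h2, h3, h.force_c hT h1 h2 h3⟩
    have htw : ∀ t, G.Adj (b t) (c t) → t ∈ T → a t ∈ T → b t ∈ T → c t ∈ T →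
        (b t ∈ T ∧ a (b t) ∈ T ∧ b (b t) ∈ T ∧ c (b t) ∈ T) ∧
        (a t ∈ T ∧ a (a t) ∈ T ∧ b (a t) ∈ T ∧ c (a t) ∈ T) ∧
        (c t ∈ T ∧ a (c t) ∈ T ∧ b (c t) ∈ T ∧ c (c t) ∈ T) := by
      intro t ht h1 h2 h3 h4
      obtain ⟨g1, g2, g3⟩ := h.t_spec ht
      obtain ⟨e1, e2⟩ := h.ta_spec ht
      obtain ⟨f1, f2⟩ := h.tc_spec ht
      refine ⟨⟨h3, ?_, ?_, ?_⟩, ?_, ?_⟩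
      · rcases g3 with g | g <;> rw [g.1] <;> assumption
      · rw [g1]; exact h1
      · rcases g3 with g | g <;> rw [g.2] <;> assumption
      · apply hin _ e1 h2
        · rcases e2 with g | g <;> rw [g.1] <;> assumption
        · rcases e2 with g | g <;> rw [g.2] <;> assumption
      · apply hin _ f1 h4
        · rcases f2 with g | g <;> rw [g.1] <;> assumption
        · rcases f2 with g | g <;> rw [g.2] <;> assumption
    by_cases hE : LE' G b c v
    · have hsp := h.s_spec hE
      rcases (h.adj v w).1 hvw with rfl | rfl | rfl
      · by_cases hw : LW G a b c v
        · have hw' := h.W_a hw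
          exact hin _ hw'.1 hav (hW _ (h.W_a hw')) (hW _ (h.W_b hw'))
        · have ht := not_not.1 (h.twin_of_end hE hw)
          obtain ⟨q1, q2, q3⟩ := h.end_spec hE ht
          have : b (a v) ∈ T := by rw [q1]; exact hbv
          rcases q3 with q3 | q3
          · have g : a (a v) ∈ T := by rw [q3]; exact hv
            exact ⟨hav, g, this, h.force_c hT hav g this⟩
          · have g : c (a v) ∈ T := by rw [q3]; exact hv
            exact ⟨hav, h.force_a hT hav this g, this, g⟩
      · by_cases hw : LW G a b c v
        · have hw' := h.W_b hw
          exact hin _ hw'.1 hbv (hW _ (h.W_a hw')) (hW _ (h.W_b hw'))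
        · have ht := not_not.1 (h.twin_of_end hE hw)
          obtain ⟨q1, q2, q3⟩ := h.end_spec hE ht
          have : b (a v) ∈ T := by rw [q1]; exact hbv
          have h5 : a (a v) ∈ T ∧ c (a v) ∈ T := by
            rcases q3 with q3 | q3
            · have g : a (a v) ∈ T := by rw [q3]; exact hv
              exact ⟨g, h.force_c hT hav g this⟩
            · have g : c (a v) ∈ T := by rw [q3]; exact hv
              exact ⟨h.force_a hT hav this g, g⟩
          have := (htw (a v) ht hav h5.1 this h5.2).1
          rwa [q1] at this
      · have hcc : c (c v) ∈ T := by rw [hsp.1]; exact hv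
        have := hR (c v) hsp.2 hcv hcc
        exact ⟨hcv, this.1, this.2, hcc⟩
    · have ht := not_not.1 hE
      obtain ⟨k1, k2, k3⟩ := htw v ht hv hav hbv hcv
      rcases (h.adj v w).1 hvw with rfl | rfl | rfl
      · exact k2
      · exact k1
      · exact k3)
  exact fun v => (hall v).1

end Loc

theorem Loc.build {V : Type*} [Fintype V] {G : SimpleGraph V} {a b c : V → V} (h : Loc G a b c)
    (S' : Finset V) (Wf : Finset V) (hWf : ∀ v, v ∈ Wf ↔ LW G a b c v) (Q : V → Prop)
    (hcard : 2 * S'.card ≤ Wf.card)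
    (htot : ∀ p ∈ S', (∃ q ∈ S', G.Adj p q) ∨
      (LE' G b c (c p) ∧ ¬ LW G a b c (c p) ∧ Q (c p) ∧ ¬ Q (Ld G a b c (c p))))
    (hforce : ∀ T : Set V, ForcingClosed G T → (∀ p ∈ S', p ∈ T) →
      (∀ x, LE' G b c x → ¬ LW G a b c x → Q x → ¬ Q (Ld G a b c x) → x ∈ T) →
      (∀ t, G.Adj (b t) (c t) → t ∈ T ∨ b t ∈ T) → ∀ v, v ∈ T) :
    2 * totalForcingNumber G ≤ Fintype.card V := by
  classical
  let e := Fintype.equivFin V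
  let A : Finset V := Finset.univ.filter (fun t => G.Adj (b t) (c t) ∧ e t < e (b t))
  have hA : ∀ t, t ∈ A ↔ G.Adj (b t) (c t) ∧ e t < e (b t) := by intro t; simp [A]
  have hAb : ∀ t, t ∈ A → b t ∉ A := by
    intro t ht hb
    rw [hA] at ht hb
    rw [(h.t_spec ht.1).1] at hb
    exact lt_asymm ht.2 hb.2
  have hAor : ∀ t, G.Adj (b t) (c t) → t ∈ A ∨ b t ∈ A := by
    intro t ht
    rcases lt_trichotomy (e t) (e (b t)) with h1 | h1 | h1
    · left; rw [hA]; exact ⟨ht, h1⟩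
    · exact absurd (e.injective h1) (h.vb t).ne
    · right; rw [hA]
      have := h.t_spec ht
      exact ⟨this.2.1, by rw [this.1]; exact h1⟩
  let comp : V → V := fun t => if Q (a t) then a t else if Q (c t) then c t else b t
  have hcompadj : ∀ t, G.Adj t (comp t) := by
    intro t
    simp only [comp]
    split_ifs
    · exact h.va t
    · exact h.vc t
    · exact h.vb t
  -- companion ends
  have hcomp : ∀ x, LE' G b c x → ¬ LW G a b c x → Q x → ¬ Q (Ld G a b c x) →
      ∃ t ∈ A, comp t = x := by
    intro x hE hW hQ hQd
    obtain ⟨t, hT, hx⟩ := h.end_eq hE hW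
    have main : ∀ t, G.Adj (b t) (c t) → (x = a t ∨ x = c t) → comp t = x := by
      rintro t hT (rfl | rfl)
      · simp only [comp, if_pos hQ]
      · rw [h.d_c hT] at hQd
        simp only [comp, if_neg hQd, if_pos hQ]
    rcases hAor t hT with h1 | h1
    · exact ⟨t, h1, main t hT hx⟩
    · have hs := h.t_spec hT
      refine ⟨b t, h1, main (b t) hs.2.1 ?_⟩
      rcases hs.2.2 with g | g <;> rw [g.1, g.2] <;> tauto
  let S : Finset V := A ∪ A.image comp ∪ S'
  have hSA : ∀ t ∈ A, t ∈ S := fun t ht => by simp [S, ht]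
  have hSc : ∀ t ∈ A, comp t ∈ S := fun t ht => by
    simp only [S, Finset.mem_union]
    exact Or.inl (Or.inr (Finset.mem_image_of_mem _ ht))
  have hSS' : ∀ t ∈ S', t ∈ S := fun t ht => by simp [S, ht]
  have hTF : IsTotalForcingSet G (S : Set V) := by
    constructor
    · intro T hST hT
      refine hforce T hT (fun p hp => hST (hSS' p hp)) ?_ ?_
      · intro x h1 h2 h3 h4
        obtain ⟨t, ht, rfl⟩ := hcomp x h1 h2 h3 h4
        exact hST (hSc t ht)
      · intro t ht
        rcases hAor t ht with h1 | h1
        · exact Or.inl (hST (hSA _ h1))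
        · exact Or.inr (hST (hSA _ h1))
    · intro v hv
      simp only [S, Finset.coe_union, Set.mem_union, Finset.mem_coe, Finset.mem_image] at hv
      rcases hv with (hv | ⟨t, ht, rfl⟩) | hv
      · exact ⟨comp v, hSc v hv, hcompadj v⟩
      · exact ⟨t, hSA t ht, (hcompadj t).symm⟩
      · rcases htot v hv with ⟨q, hq, hadj⟩ | ⟨h1, h2, h3, h4⟩
        · exact ⟨q, hSS' q hq, hadj⟩
        · obtain ⟨t, ht, hx⟩ := hcomp _ h1 h2 h3 h4
          exact ⟨c v, hx ▸ hSc t ht, h.vc v⟩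
  have hle : totalForcingNumber G ≤ S.card :=
    Nat.sInf_le ⟨(S : Set V), hTF, Set.ncard_coe_finset S⟩
  have hScard : S.card ≤ A.card + A.card + S'.card := by
    refine (Finset.card_union_le _ _).trans ?_
    refine Nat.add_le_add_right ((Finset.card_union_le _ _).trans ?_) _
    exact Nat.add_le_add_left Finset.card_image_le _
  -- counting
  have hEA : ∀ t ∈ A, LE' G b c (a t) ∧ LE' G b c (c t) := fun t ht =>
    ⟨(h.ta_spec ((hA t).1 ht).1).1, (h.tc_spec ((hA t).1 ht).1).1⟩
  have huniq : ∀ t ∈ A, ∀ u ∈ A, ∀ x, G.Adj t x → G.Adj u x → LE' G b c x → t = u := by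
    intro t ht u hu x htx hux hx
    have hT := ((hA t).1 ht).1
    have hU := ((hA u).1 hu).1
    have hin : ∀ t ∈ A, G.Adj t x → (t = a x ∨ t = b x) ∧ ¬ LW G a b c x := by
      intro t ht htx
      have hT := ((hA t).1 ht).1
      have h1 := h.t_spec hT
      rcases (h.adj t x).1 htx with rfl | rfl | rfl
      · refine ⟨?_, h.notW_a hT⟩
        rcases (h.ta_spec hT).2 with g | g
        · exact Or.inl g.1.symm
        · exact Or.inr g.2.symm
      · exact absurd h1.2.1 hx
      · refine ⟨?_, h.notW_c hT⟩
        rcases (h.tc_spec hT).2 with g | g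
        · exact Or.inl g.1.symm
        · exact Or.inr g.2.symm
    have h1 := hin t ht htx
    have h2 := hin u hu hux
    have h3 := (h.end_spec hx (not_not.1 (h.twin_of_end hx h1.2))).1
    rcases h1.1 with g1 | g1 <;> rcases h2.1 with g2 | g2
    · rw [g1, g2]
    · exfalso; apply hAb t ht; rw [g1, h3, ← g2]; exact hu
    · exfalso; apply hAb u hu; rw [g2, h3, ← g1]; exact ht
    · rw [g1, g2]
  have hAT : ∀ t ∈ A, ¬ LE' G b c t := fun t ht => not_not.2 ((hA t).1 ht).1
  have hbT : ∀ t ∈ A, ¬ LE' G b c (b t) := fun t ht =>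
    not_not.2 (h.t_spec ((hA t).1 ht).1).2.1
  have hib : (A.image b).card = A.card := by
    apply Finset.card_image_of_injOn
    intro t ht u hu htu
    have h1 := (h.t_spec ((hA t).1 ht).1).1
    have h2 := (h.t_spec ((hA u).1 hu).1).1
    rw [← h1, ← h2, htu]
  have hia : (A.image a).card = A.card := by
    apply Finset.card_image_of_injOn
    intro t ht u hu htu
    exact huniq t ht u hu (a t) (h.va t) (by rw [htu]; exact h.va u) (hEA t ht).1
  have hic : (A.image c).card = A.card := by
    apply Finset.card_image_of_injOn
    intro t ht u hu htu
    exact huniq t ht u hu (c t) (h.vc t) (by rw [htu]; exact h.vc u) (hEA t ht).2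
  have hd1 : Disjoint A (A.image b) := by
    rw [Finset.disjoint_left]
    intro x hx hx'
    obtain ⟨t, ht, rfl⟩ := Finset.mem_image.1 hx'
    exact hAb t ht hx
  have hd2 : Disjoint (A ∪ A.image b) (A.image a) := by
    rw [Finset.disjoint_left]
    intro x hx hx'
    obtain ⟨t, ht, rfl⟩ := Finset.mem_image.1 hx'
    rcases Finset.mem_union.1 hx with hx | hx
    · exact hAT _ hx (hEA t ht).1
    · obtain ⟨u, hu, hux⟩ := Finset.mem_image.1 hx
      exact hbT u hu (hux ▸ (hEA t ht).1)
  have hd3 : Disjoint (A ∪ A.image b ∪ A.image a) (A.image c) := by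
    rw [Finset.disjoint_left]
    intro x hx hx'
    obtain ⟨t, ht, rfl⟩ := Finset.mem_image.1 hx'
    rcases Finset.mem_union.1 hx with hx | hx
    · rcases Finset.mem_union.1 hx with hx | hx
      · exact hAT _ hx (hEA t ht).2
      · obtain ⟨u, hu, hux⟩ := Finset.mem_image.1 hx
        exact hbT u hu (hux ▸ (hEA t ht).2)
    · obtain ⟨u, hu, hux⟩ := Finset.mem_image.1 hx
      have : t = u := huniq t ht u hu (c t) (h.vc t) (hux ▸ h.va u) (hEA t ht).2
      subst this
      exact h.ac t hux
  have hd4 : Disjoint (A ∪ A.image b ∪ A.image a ∪ A.image c) Wf := by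
    rw [Finset.disjoint_left]
    intro x hx hxW
    rw [hWf] at hxW
    rcases Finset.mem_union.1 hx with hx | hx
    · rcases Finset.mem_union.1 hx with hx | hx
      · rcases Finset.mem_union.1 hx with hx | hx
        · exact hAT _ hx hxW.1
        · obtain ⟨u, hu, rfl⟩ := Finset.mem_image.1 hx
          exact hbT u hu hxW.1
      · obtain ⟨u, hu, rfl⟩ := Finset.mem_image.1 hx
        exact h.notW_a ((hA u).1 hu).1 hxW
    · obtain ⟨u, hu, rfl⟩ := Finset.mem_image.1 hx
      exact h.notW_c ((hA u).1 hu).1 hxW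
  have hcnt := Finset.card_le_univ (A ∪ A.image b ∪ A.image a ∪ A.image c ∪ Wf)
  rw [Finset.card_union_of_disjoint hd4, Finset.card_union_of_disjoint hd3,
    Finset.card_union_of_disjoint hd2, Finset.card_union_of_disjoint hd1, hia, hib, hic] at hcnt
  omega

theorem Loc.main {V : Type*} [Fintype V] {G : SimpleGraph V} {a b c : V → V} (h : Loc G a b c)
    (hconn : G.Connected) : 2 * totalForcingNumber G ≤ Fintype.card V := by
  classical
  let Wf : Finset V := Finset.univ.filter (fun v => LW G a b c v)
  have hWf : ∀ v, v ∈ Wf ↔ LW G a b c v := by intro v; simp [Wf]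
  by_cases hne : Wf.Nonempty
  · -- there are triangle units
    obtain ⟨m, m1, m2, m3, m4, m5, m6, m7⟩ := wire_map (LE' G b c) (LW G a b c)
      (Ls G b c) (Ld G a b c) h.s_s h.d_d
      (fun v hE => by rw [Loc.s_E hE]; exact (h.s_spec hE).2) h.d_E
      (fun v hE => by rw [Loc.s_E hE]; exact (h.vc v).ne.symm) (fun v hW => Loc.d_W hW) h.d_fix
      (fun v hW => hW.1)
    let tri : V → Finset V := fun v => {v, a v, b v}
    have htri : ∀ p q, q ∈ tri p ↔ q = p ∨ q = a p ∨ q = b p := by intro p q; simp [tri]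
    obtain ⟨S', hS'W, hcard, htot, hforce⟩ := abstract_greedy Wf tri m hne
      (fun p hp => by rw [htri]; exact Or.inl rfl)
      (fun p hp q hq => by
        rw [htri] at hq
        rw [hWf] at *
        rcases hq with rfl | rfl | rfl
        · exact hp
        · exact h.W_a hp
        · exact h.W_b hp)
      (fun p hp => Finset.card_eq_three.2 ⟨p, a p, b p, (h.va p).ne, (h.vb p).ne, h.ab p, rfl⟩)
      (fun p hp q hq => by
        rw [htri] at hq
        rw [hWf] at hp
        have hs := h.tri_spec hp.2.1 hp.2.2
        ext z
        rw [htri, htri]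
        rcases hq with rfl | rfl | rfl
        · rfl
        · rcases hs.1 with g | g <;> rw [g.1, g.2] <;> tauto
        · rcases hs.2 with g | g <;> rw [g.1, g.2] <;> tauto)
      (fun p hp => by rw [hWf] at *; exact m1 p hp)
      (fun p hp => by rw [hWf] at *; exact m2 p hp)
      (fun p hp => by rw [hWf] at *; exact m3 p hp)
      (by
        intro X hXW hXne hXtri hXm
        obtain ⟨Z, hZE, hZs, hZd, hZX⟩ := m7 (fun v => v ∈ X)
          (fun p hp => (hWf p).1 (hXW hp)) hXm
        have hZc : ∀ v, Z v → Z (c v) := by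
          intro v hv
          have := hZs v hv
          rwa [Loc.s_E (hZE v hv)] at this
        obtain ⟨v0, hv0⟩ := hXne
        have hac : ∀ t, G.Adj (b t) (c t) → (Z (a t) ↔ Z (c t)) := by
          intro t ht
          constructor
          · intro hz
            have := hZd _ hz
            rwa [h.d_a ht] at this
          · intro hz
            have := hZd _ hz
            rwa [h.d_c ht] at this
        have hall := closed_univ hconn (fun v => Z v ∨ (G.Adj (b v) (c v) ∧ Z (a v))) v0
          (Or.inl ((hZX v0 ((hWf v0).1 (hXW hv0))).2 hv0)) (by
            intro v w hvw hv
            rcases hv with hv | ⟨ht, hv⟩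
            · have hE := hZE v hv
              by_cases hW : LW G a b c v
              · have hvX := (hZX v hW).1 hv
                rcases (h.adj v w).1 hvw with rfl | rfl | rfl
                · exact Or.inl ((hZX _ (h.W_a hW)).2 (hXtri v hvX (by rw [htri]; simp)))
                · exact Or.inl ((hZX _ (h.W_b hW)).2 (hXtri v hvX (by rw [htri]; simp)))
                · exact Or.inl (hZc v hv)
              · have ht := not_not.1 (h.twin_of_end hE hW)
                obtain ⟨q1, q2, q3⟩ := h.end_spec hE ht
                have hz : Z (a (a v)) := by
                  rcases q3 with q | q
                  · rw [q]; exact hv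
                  · rw [hac _ ht, q]; exact hv
                rcases (h.adj v w).1 hvw with rfl | rfl | rfl
                · exact Or.inr ⟨ht, hz⟩
                · refine Or.inr ⟨q2, ?_⟩
                  rcases (h.t_spec ht).2.2 with g | g
                  · rw [← q1, g.1]; exact hz
                  · rw [← q1, g.1, ← hac _ ht]; exact hz
                · exact Or.inl (hZc v hv)
            · rcases (h.adj v w).1 hvw with rfl | rfl | rfl
              · exact Or.inl hv
              · refine Or.inr ⟨(h.t_spec ht).2.1, ?_⟩
                rcases (h.t_spec ht).2.2 with g | g
                · rw [g.1]; exact hv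
                · rw [g.1, ← hac _ ht]; exact hv
              · exact Or.inl ((hac _ ht).1 hv))
        refine Finset.Subset.antisymm hXW (fun w hw => ?_)
        rw [hWf] at hw
        rcases hall w with h1 | h1
        · exact (hZX w hw).1 h1
        · exact absurd h1.1 hw.1)
    -- the loop facts
    have hloop : ∀ p ∈ S', m p ∈ tri p → LE' G b c (c p) ∧ ¬ LW G a b c (c p) ∧
        ((∃ q ∈ S', Ld G a b c (c p) = c q) → m p ∈ S') := by
      intro p hp hm
      have hpW := (hWf p).1 (hS'W hp)
      have hE := (h.s_spec hpW.1).2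
      have hnW : ¬ LW G a b c (c p) := by
        intro hW
        have := m5 p hpW (by rw [Loc.s_E hpW.1]; exact hW)
        rw [Loc.s_E hpW.1] at this
        rw [this, htri] at hm
        rcases hm with g | g | g
        · exact (h.vc p).ne g.symm
        · exact h.ac p g.symm
        · exact h.bc p g.symm
      refine ⟨hE, hnW, ?_⟩
      rintro ⟨q, hq, hqd⟩
      have hqW := (hWf q).1 (hS'W hq)
      have e1 : Ls G b c (Ld G a b c (Ls G b c p)) = q := by
        rw [Loc.s_E hpW.1, hqd, Loc.s_E (h.s_spec hqW.1).2, (h.s_spec hqW.1).1]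
      have := m6 p hpW (by rw [Loc.s_E hpW.1]; exact hnW) (by rw [e1]; exact hqW)
      rw [this, e1]; exact hq
    refine h.build S' Wf hWf (fun x => ∃ q ∈ S', x = c q) hcard ?_ ?_
    · intro p hp
      have htadj : ∀ q, q ≠ p → q ∈ tri p → G.Adj p q := by
        intro q hne hq
        rw [htri] at hq
        rcases hq with rfl | rfl | rfl
        · exact absurd rfl hne
        · exact h.va p
        · exact h.vb p
      rcases htot p hp with ⟨q, hq, hne, hqt⟩ | hm
      · exact Or.inl ⟨q, hq, htadj q hne hqt⟩
      · obtain ⟨l1, l2, l3⟩ := hloop p hp hm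
        by_cases hmS : m p ∈ S'
        · exact Or.inl ⟨m p, hmS, htadj _ (m3 p ((hWf p).1 (hS'W hp))) hm⟩
        · exact Or.inr ⟨l1, l2, ⟨p, hp, rfl⟩, fun hq => hmS (l3 hq)⟩
    · intro T hT hST hcompT hAT
      have hR : ∀ p, LW G a b c p → p ∈ T → c p ∈ T → m p ∈ T ∧ c (m p) ∈ T := by
        intro p hp h1 h2
        refine m4 (fun v => v ∈ T ∧ c v ∈ T) ?_ ?_ p hp ⟨h1, h2⟩
        · rintro v hE ⟨g1, g2⟩
          rw [Loc.s_E hE, (h.s_spec hE).1]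
          exact ⟨g2, g1⟩
        · rintro v hE ⟨g1, g2⟩
          exact h.trans_end hT hAT hE g1 g2
      have hfull : ∀ p ∈ Wf, p ∈ T := by
        refine hforce T {v | c v ∈ T} hST ?_ ?_ ?_
        · intro p hp q hq hpq h1 h2 h3 r hr
          rw [htri] at hq hr
          have h3' : c p ∈ T := h3
          have hab : a p ∈ T ∧ b p ∈ T := by
            rcases hq with rfl | rfl | rfl
            · exact absurd rfl hpq
            · exact ⟨h2, h.force_b hT h1 h2 h3'⟩
            · exact ⟨h.force_a hT h1 h2 h3', h2⟩
          rcases hr with rfl | rfl | rfl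
          · exact h1
          · exact hab.1
          · exact hab.2
        · intro p hp hr
          have h1 := hr p (by rw [htri]; simp)
          have h2 := h.force_c hT h1 (hr (a p) (by rw [htri]; simp))
            (hr (b p) (by rw [htri]; simp))
          exact hR p ((hWf p).1 hp) h1 h2
        · intro p hp hm hmS
          obtain ⟨l1, l2, l3⟩ := hloop p hp hm
          exact hcompT (c p) l1 l2 ⟨p, hp, rfl⟩ (fun hq => hmS (l3 hq))
      have hfull' : ∀ v, LW G a b c v → v ∈ T := fun v hv => hfull v ((hWf v).2 hv)
      obtain ⟨p, hp⟩ := hne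
      have hpW := (hWf p).1 hp
      exact h.final_force hconn hT hAT hfull' p (hfull p hp) hpW.1
        (h.force_c hT (hfull p hp) (hfull' _ (h.W_a hpW)) (hfull' _ (h.W_b hpW)))
  · -- diamond necklaces
    have hnW : ∀ v, ¬ LW G a b c v := fun v hv => hne ⟨v, (hWf v).2 hv⟩
    obtain ⟨v⟩ := hconn.nonempty
    obtain ⟨x, hx⟩ : ∃ x, LE' G b c x := by
      by_cases hE : LE' G b c v
      · exact ⟨v, hE⟩
      · exact ⟨a v, (h.ta_spec (not_not.1 hE)).1⟩
    have hsx := h.s_spec hx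
    have hdx : Ld G a b c x ≠ x := fun hd => hnW x (h.d_fix x hx hd)
    have hdx' := h.d_nadj hx
    have hdc : Ld G a b c (c x) ≠ c x := fun hd => hnW _ (h.d_fix _ hsx.2 hd)
    have hdc' : Ld G a b c (c x) ≠ x := by
      have := h.d_nadj (v := c x) hsx.2
      rwa [hsx.1] at this
    refine h.build ∅ Wf hWf (fun y => y = x ∨ y = c x) (by simp) (by simp) ?_
    intro T hT _ hcompT hAT
    have h1 := hcompT x hx (hnW x) (Or.inl rfl) (by rintro (g | g); exacts [hdx g, hdx' g])
    have h2 := hcompT (c x) hsx.2 (hnW _) (Or.inr rfl) (by rintro (g | g); exacts [hdc' g, hdc g])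
    exact h.final_force hconn hT hAT (fun v hv => absurd hv (hnW v)) x h1 hx h2

/-- If `G ≠ K₄` is a connected, claw-free, cubic graph of order `n`, then
`F_t(G) ≤ n/2`. -/
theorem totalForcingNumber_le_half_of_clawFree_cubic {V : Type*} [Fintype V]
    (G : SimpleGraph V) (hconn : G.Connected) (hcf : ClawFree G) (hcubic : IsCubic G)
    (hK4 : ¬ Nonempty (G ≃g (⊤ : SimpleGraph (Fin 4)))) :
    2 * totalForcingNumber G ≤ Fintype.card V := by
  obtain ⟨a, b, c, h⟩ := exists_loc G hconn hcf hcubic hK4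
  exact h.main hconn
end

section
/- If G is a connected, claw-free, cubic graph of order n that is not isomorphic to K_4, then F_t(G) = n/2 if and only if G is isomorphic to a diamond-necklace N_k for some k ≥ 2 or G is isomorphic to the prism C_3 □ K_2. -/
/-- The prism `C₃ □ K₂`, the Cartesian (box) product of a 3-cycle with `K₂`. -/
def prism : SimpleGraph (Fin 3 × Fin 2) :=
  (SimpleGraph.cycleGraph 3).boxProd (⊤ : SimpleGraph (Fin 2))

/-- The diamond-necklace `N_k`.  Its vertices are pairs `(i, j)` with `i : Fin k`
indexing the diamond and `j : Fin 4` the position inside diamond `D_i`, where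
`j = 0, 1, 2, 3` correspond to the vertices `a_i, b_i, c_i, d_i` respectively and
`a_i b_i` is the missing edge of the diamond.  Two vertices in the same diamond are
adjacent unless they are `a_i` and `b_i`, and in addition `a_i` is joined to `b_{i+1}`
(indices modulo `k`). -/
def diamondNecklace (k : ℕ) : SimpleGraph (Fin k × Fin 4) :=
  SimpleGraph.fromRel (fun p q =>
    (p.1 = q.1 ∧ ¬ ((p.2 = 0 ∧ q.2 = 1) ∨ (p.2 = 1 ∧ q.2 = 0))) ∨
    ((q.1 : ℕ) = ((p.1 : ℕ) + 1) % k ∧ p.2 = 0 ∧ q.2 = 1))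

set_option linter.unusedSectionVars false

section Aux

variable {V : Type*} {G : SimpleGraph V}

/-- The neighbours of `v` are exactly the three distinct vertices `p, q, r`. -/
structure Nb (G : SimpleGraph V) (v p q r : V) : Prop where
  pq : p ≠ q
  pr : p ≠ r
  qr : q ≠ r
  adj : ∀ w, G.Adj v w ↔ (w = p ∨ w = q ∨ w = r)

/-- A diamond with ends `a, b`, middles `c, d`, and outer neighbours of the ends. -/
structure Dia (G : SimpleGraph V) (a b c d a' b' : V) : Prop where
  ha : Nb G a c d a'
  hb : Nb G b c d b'
  hc : Nb G c a b d
  hd : Nb G d a b c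
  nab : ¬ G.Adj a b

def InDia (G : SimpleGraph V) (v : V) : Prop :=
  ∃ a b c d a' b', Dia G a b c d a' b' ∧ (v = a ∨ v = c)

/-- A triangle unit `x y z` with outer neighbours. -/
structure Tri (G : SimpleGraph V) (x y z x' y' z' : V) : Prop where
  hx : Nb G x y z x'
  hy : Nb G y x z y'
  hz : Nb G z x y z'
  nx : ¬ InDia G x
  ny : ¬ InDia G y
  nz : ¬ InDia G z

def NoK4 (G : SimpleGraph V) : Prop :=
  ∀ a b c d, G.Adj a b → G.Adj a c → G.Adj a d → G.Adj b c → G.Adj b d → G.Adj c d → False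

lemma Dia.swapE {a b c d a' b' : V} (h : Dia G a b c d a' b') : Dia G b a c d b' a' := by
  obtain ⟨⟨h1,h2,h3,h4⟩,⟨h5,h6,h7,h8⟩,⟨h9,h10,h11,h12⟩,⟨h13,h14,h15,h16⟩,h17⟩ := h
  refine ⟨⟨h5,h6,h7,h8⟩,⟨h1,h2,h3,h4⟩,⟨h9.symm,h11,h10,?_⟩,⟨h9.symm,h15,h14,?_⟩,fun h => h17 h.symm⟩
  · intro w; rw [h12]; tauto
  · intro w; rw [h16]; tauto

lemma Dia.swapM {a b c d a' b' : V} (h : Dia G a b c d a' b') : Dia G a b d c a' b' := by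
  obtain ⟨⟨h1,h2,h3,h4⟩,⟨h5,h6,h7,h8⟩,h9,h10,h17⟩ := h
  refine ⟨⟨h1.symm,h3,h2,?_⟩,⟨h5.symm,h7,h6,?_⟩,h10,h9,h17⟩
  · intro w; rw [h4]; tauto
  · intro w; rw [h8]; tauto

lemma Dia.inA {a b c d a' b' : V} (h : Dia G a b c d a' b') : InDia G a := ⟨a,b,c,d,a',b',h,.inl rfl⟩
lemma Dia.inC {a b c d a' b' : V} (h : Dia G a b c d a' b') : InDia G c := ⟨a,b,c,d,a',b',h,.inr rfl⟩
lemma Dia.inB {a b c d a' b' : V} (h : Dia G a b c d a' b') : InDia G b := h.swapE.inA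
lemma Dia.inD {a b c d a' b' : V} (h : Dia G a b c d a' b') : InDia G d := h.swapM.inC

lemma Nb.perm1 {v p q r : V} (h : Nb G v p q r) : Nb G v q p r := by
  obtain ⟨h1,h2,h3,h4⟩ := h
  exact ⟨h1.symm, h3, h2, fun w => by rw [h4]; tauto⟩

lemma Nb.perm2 {v p q r : V} (h : Nb G v p q r) : Nb G v p r q := by
  obtain ⟨h1,h2,h3,h4⟩ := h
  exact ⟨h2, h1, h3.symm, fun w => by rw [h4]; tauto⟩

lemma Tri.rot {x y z x' y' z' : V} (h : Tri G x y z x' y' z') : Tri G y x z y' x' z' :=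
  ⟨h.hy, h.hx, h.hz.perm1, h.ny, h.nx, h.nz⟩
lemma Tri.swap {x y z x' y' z' : V} (h : Tri G x y z x' y' z') : Tri G x z y x' z' y' :=
  ⟨h.hx.perm1, h.hz, h.hy, h.nx, h.nz, h.ny⟩

lemma Nb.exists (hcf : ClawFree G) (hc : IsCubic G) (v : V) : ∃ p q r, Nb G v p q r ∧ G.Adj p q := by
  obtain ⟨p, q, r, h1, h2, h3, h4⟩ := Set.ncard_eq_three.1 (hc v)
  have hn : Nb G v p q r := ⟨h1, h2, h3, fun w => by
    rw [← SimpleGraph.mem_neighborSet, h4]; simp⟩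
  by_cases hpq : G.Adj p q
  · exact ⟨p, q, r, hn, hpq⟩
  by_cases hpr : G.Adj p r
  · exact ⟨p, r, q, hn.perm2, hpr⟩
  by_cases hqr : G.Adj q r
  · exact ⟨q, r, p, hn.perm1.perm2, hqr⟩
  exact (hcf ⟨v, p, q, r, by simp [hn.adj], by simp [hn.adj], by simp [hn.adj], h1, h2, h3, hpq, hpr, hqr⟩).elim

/-- Third neighbour. -/
lemma Nb.third (hc : IsCubic G) {v p q : V} (h1 : G.Adj v p) (h2 : G.Adj v q) (hpq : p ≠ q) :
    ∃ r, Nb G v p q r := by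
  obtain ⟨a, b, c, h3, h4, h5, h6⟩ := Set.ncard_eq_three.1 (hc v)
  have hn : Nb G v a b c := ⟨h3, h4, h5, fun w => by
    rw [← SimpleGraph.mem_neighborSet, h6]; simp⟩
  have e1 := (hn.adj p).1 h1
  have e2 := (hn.adj q).1 h2
  rcases e1 with rfl | rfl | rfl <;> rcases e2 with rfl | rfl | rfl <;> first
    | exact absurd rfl hpq
    | exact ⟨_, hn⟩ | exact ⟨_, hn.perm1⟩ | exact ⟨_, hn.perm2⟩
    | exact ⟨_, hn.perm1.perm2⟩ | exact ⟨_, hn.perm2.perm1⟩ | exact ⟨_, hn.perm2.perm1.perm2⟩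

lemma Dia.mk' (hc : IsCubic G) {a b c d : V} (hab : a ≠ b) (nab : ¬ G.Adj a b) (h1 : G.Adj a c)
    (h2 : G.Adj a d) (h3 : G.Adj b c) (h4 : G.Adj b d) (h5 : G.Adj c d) :
    ∃ a' b', Dia G a b c d a' b' := by
  obtain ⟨a', ha⟩ := Nb.third hc h1 h2 h5.ne
  obtain ⟨b', hb⟩ := Nb.third hc h3 h4 h5.ne
  obtain ⟨e, he⟩ := Nb.third hc h1.symm h3.symm hab
  obtain ⟨f, hf⟩ := Nb.third hc h2.symm h4.symm hab
  have e1 : e = d := by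
    rcases (he.adj d).1 h5 with h | h | h
    · exact absurd h h2.ne'
    · exact absurd h h4.ne'
    · exact h.symm
  have e2 : f = c := by
    rcases (hf.adj c).1 h5.symm with h | h | h
    · exact absurd h h1.ne'
    · exact absurd h h3.ne'
    · exact h.symm
  subst e1 e2
  exact ⟨a', b', ha, hb, he, hf, nab⟩

/-- membership in a diamond propagates along triangles -/
lemma InDia.tri {u v w : V} (hu : InDia G u) (h1 : G.Adj u v) (h2 : G.Adj v w) (h3 : G.Adj u w) :
    InDia G v := by
  obtain ⟨a, b, c, d, a', b', h, rfl | rfl⟩ := hu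
  · rcases (h.ha.adj v).1 h1 with rfl | rfl | rfl
    · exact h.inC
    · exact h.inD
    · exfalso
      rcases (h.ha.adj w).1 h3 with rfl | rfl | rfl
      · rcases (h.hc.adj _).1 h2.symm with e | e | e
        · exact h1.ne e.symm
        · exact h.nab (e ▸ h1)
        · exact h.ha.qr e.symm
      · rcases (h.hd.adj _).1 h2.symm with e | e | e
        · exact h1.ne e.symm
        · exact h.nab (e ▸ h1)
        · exact h.ha.pr e.symm
      · exact h2.ne rfl
  · rcases (h.hc.adj v).1 h1 with rfl | rfl | rfl
    · exact h.inA
    · exact h.inB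
    · exact h.inD

lemma Tri.exists (hcf : ClawFree G) (hc : IsCubic G) {x : V} (hx : ¬ InDia G x) :
    ∃ y z x' y' z', Tri G x y z x' y' z' := by
  obtain ⟨y, z, x', hn, hyz⟩ := Nb.exists hcf hc x
  have hxy : G.Adj x y := by simp [hn.adj]
  have hxz : G.Adj x z := by simp [hn.adj]
  obtain ⟨y', hy⟩ := Nb.third hc hxy.symm hyz hxz.ne
  obtain ⟨z', hz⟩ := Nb.third hc hxz.symm hyz.symm hxy.ne
  exact ⟨y, z, x', y', z', hn, hy, hz, hx, fun h => hx (h.tri hxy.symm hxz hyz),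
    fun h => hx (h.tri hxz.symm hxy hyz.symm)⟩

/-- outer neighbours of a triangle are not in the triangle, and are distinct -/
lemma Tri.out (hc : IsCubic G) (hK : NoK4 G) {x y z x' y' z' : V} (h : Tri G x y z x' y' z') :
    x' ≠ x ∧ x' ≠ y ∧ x' ≠ z ∧ x' ≠ y' ∧ x' ≠ z' := by
  have hxy : G.Adj x y := by simp [h.hx.adj]
  have hxz : G.Adj x z := by simp [h.hx.adj]
  have hyz : G.Adj y z := by simp [h.hy.adj]
  have hxx : G.Adj x x' := by simp [h.hx.adj]
  have hyy : G.Adj y y' := by simp [h.hy.adj]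
  have hzz : G.Adj z z' := by simp [h.hz.adj]
  refine ⟨hxx.ne', h.hx.pr.symm, h.hx.qr.symm, ?_, ?_⟩
  · rintro rfl
    by_cases hh : G.Adj z x'
    · exact hK x y z x' hxy hxz hxx hyz hyy hh
    · obtain ⟨_, _, hd⟩ := Dia.mk' hc h.hx.qr hh hxz.symm hyz.symm hxx.symm hyy.symm hxy
      exact h.nx hd.inC
  · rintro rfl
    by_cases hh : G.Adj y x'
    · exact hK x y z x' hxy hxz hxx hyz hh hzz
    · obtain ⟨_, _, hd⟩ := Dia.mk' hc h.hx.pr hh hxy.symm hyz hxx.symm hzz.symm hxz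
      exact h.nx hd.inC

def TC (G : SimpleGraph V) (T : Finset V) : Prop :=
  ∀ u v w, G.Adj u v → G.Adj v w → G.Adj u w → u ∈ T → v ∈ T

def Reach (G : SimpleGraph V) (S T : Finset V) : Prop :=
  ∀ X : Set V, (∀ v ∈ S, v ∈ X) → ForcingClosed G X → ∀ v ∈ T, v ∈ X

def Tot (G : SimpleGraph V) (S : Finset V) : Prop := ∀ v ∈ S, ∃ w ∈ S, G.Adj v w

lemma force {X : Set V} (hX : ForcingClosed G X) {v p q r : V} (h : Nb G v p q r)
    (hv : v ∈ X) (hp : p ∈ X) (hq : q ∈ X) : r ∈ X := by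
  refine hX v hv r (by simp [h.adj]) ?_
  intro u hu hu'
  rcases (h.adj u).1 hu with rfl | rfl | rfl
  · exact absurd hp hu'
  · exact absurd hq hu'
  · rfl

/-- boundary vertices have a single outer neighbour -/
lemma TC.boundary (hcf : ClawFree G) (hc : IsCubic G) {T : Finset V} (hT : TC G T) {u w : V}
    (hu : u ∈ T) (hw : w ∉ T) (h : G.Adj u w) : ∃ p q, Nb G u p q w ∧ p ∈ T ∧ q ∈ T ∧ G.Adj p q := by
  obtain ⟨p, q, r, hn, hpq⟩ := Nb.exists hcf hc u
  have h1 : G.Adj u p := by simp [hn.adj]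
  have h2 : G.Adj u q := by simp [hn.adj]
  have hp := hT u p q h1 hpq h2 hu
  have hq := hT u q p h2 hpq.symm h1 hu
  rcases (hn.adj w).1 h with rfl | rfl | rfl
  · exact absurd hp hw
  · exact absurd hq hw
  · exact ⟨p, q, hn, hp, hq, hpq⟩

lemma TC.frontier (hcf : ClawFree G) (hc : IsCubic G) {T : Finset V} (hT : TC G T) {X : Set V}
    (hX : ForcingClosed G X) (hTX : ∀ v ∈ T, v ∈ X) {u w : V} (hu : u ∈ T) (h : G.Adj u w) : w ∈ X := by
  by_cases hw : w ∈ T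
  · exact hTX w hw
  obtain ⟨p, q, hn, hp, hq, -⟩ := hT.boundary hcf hc hu hw h
  exact force hX hn (hTX _ hu) (hTX _ hp) (hTX _ hq)

lemma TC.uniq (hcf : ClawFree G) (hc : IsCubic G) {T : Finset V} (hT : TC G T) {u u' w : V}
    (hu : u ∈ T) (hu' : u' ∈ T) (hw : w ∉ T) (h : G.Adj u w) (h' : G.Adj u' w) : u = u' := by
  obtain ⟨p, q, r, hn, hpq⟩ := Nb.exists hcf hc w
  have h1 : G.Adj w p := by simp [hn.adj]
  have h2 : G.Adj w q := by simp [hn.adj]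
  have hp : p ∉ T := fun hp => hw (hT p w q h1.symm h2 hpq hp)
  have hq : q ∉ T := fun hq => hw (hT q w p h2.symm h1 hpq.symm hq)
  have e1 := (hn.adj u).1 h.symm
  have e2 := (hn.adj u').1 h'.symm
  grind

section Dec
variable [DecidableEq V]

lemma TC.union {T T' : Finset V} (h : TC G T) (h' : TC G T') : TC G (T ∪ T') := by
  intro u v w h1 h2 h3 hu
  rw [Finset.mem_union] at *
  exact hu.imp (h u v w h1 h2 h3) (h' u v w h1 h2 h3)

lemma Tot.union {T T' : Finset V} (h : Tot G T) (h' : Tot G T') : Tot G (T ∪ T') := by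
  intro v hv
  rw [Finset.mem_union] at hv
  rcases hv with hv | hv
  · obtain ⟨w, hw, e⟩ := h v hv
    exact ⟨w, Finset.mem_union_left _ hw, e⟩
  · obtain ⟨w, hw, e⟩ := h' v hv
    exact ⟨w, Finset.mem_union_right _ hw, e⟩

lemma Dia.tc {a b c d a' b' : V} (h : Dia G a b c d a' b') : TC G {a, b, c, d} := by
  have key : ∀ {a b c d a' b' : V}, Dia G a b c d a' b' → ∀ v w, G.Adj a v → G.Adj v w → G.Adj a w →
      v = c ∨ v = d := by
    intro a b c d a' b' h v w h1 h2 h3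
    rcases (h.ha.adj v).1 h1 with rfl | rfl | rfl
    · simp
    · simp
    · exfalso
      rcases (h.ha.adj w).1 h3 with rfl | rfl | rfl
      · rcases (h.hc.adj _).1 h2.symm with e | e | e
        · exact h1.ne e.symm
        · exact h.nab (e ▸ h1)
        · exact h.ha.qr e.symm
      · rcases (h.hd.adj _).1 h2.symm with e | e | e
        · exact h1.ne e.symm
        · exact h.nab (e ▸ h1)
        · exact h.ha.pr e.symm
      · exact h2.ne rfl
  intro u v w h1 h2 h3 hu
  simp only [Finset.mem_insert, Finset.mem_singleton] at hu ⊢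
  rcases hu with rfl | rfl | rfl | rfl
  · have := key h v w h1 h2 h3; tauto
  · have := key h.swapE v w h1 h2 h3; tauto
  · have := (h.hc.adj v).1 h1; tauto
  · have := (h.hd.adj v).1 h1; tauto

lemma Tri.tc (hc : IsCubic G) (hK : NoK4 G) {x y z x' y' z' : V} (h : Tri G x y z x' y' z') :
    TC G {x, y, z} := by
  have key : ∀ {x y z x' y' z' : V}, Tri G x y z x' y' z' → ∀ v w, G.Adj x v → G.Adj v w → G.Adj x w →
      v = y ∨ v = z := by
    intro x y z x' y' z' h v w h1 h2 h3
    have o := h.out hc hK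
    rcases (h.hx.adj v).1 h1 with rfl | rfl | rfl
    · simp
    · simp
    · exfalso
      rcases (h.hx.adj w).1 h3 with rfl | rfl | rfl
      · rcases (h.hy.adj _).1 h2.symm with e | e | e <;> tauto
      · rcases (h.hz.adj _).1 h2.symm with e | e | e <;> tauto
      · exact h2.ne rfl
  intro u v w h1 h2 h3 hu
  simp only [Finset.mem_insert, Finset.mem_singleton] at hu ⊢
  rcases hu with rfl | rfl | rfl
  · have := key h v w h1 h2 h3; tauto
  · have := key h.rot v w h1 h2 h3; tauto
  · have := key h.swap.rot v w h1 h2 h3; tauto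

end Dec

lemma Dia.entry {T : Finset V} (hT : TC G T) {u w : V} (hu : u ∈ T) (hw : w ∉ T) (h : G.Adj u w)
    (hd : InDia G w) : ∃ b c d b', Dia G w b c d u b' := by
  obtain ⟨a, b, c, d, a', b', h1, rfl | rfl⟩ := hd
  · have hwc : G.Adj w c := by simp [h1.ha.adj]
    have hwd : G.Adj w d := by simp [h1.ha.adj]
    have hcd : G.Adj c d := by simp [h1.hc.adj]
    rcases (h1.ha.adj u).1 h.symm with rfl | rfl | rfl
    · exact absurd (hT u w d h hwd hcd hu) hw
    · exact absurd (hT u w c h hwc hcd.symm hu) hw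
    · exact ⟨b, c, d, b', h1⟩
  · exfalso
    have hwa : G.Adj w a := by simp [h1.hc.adj]
    have hwb : G.Adj w b := by simp [h1.hc.adj]
    have hwd : G.Adj w d := by simp [h1.hc.adj]
    have had : G.Adj a d := by simp [h1.ha.adj]
    have hbd : G.Adj b d := by simp [h1.hb.adj]
    rcases (h1.hc.adj u).1 h.symm with rfl | rfl | rfl
    · exact hw (hT u w d h hwd had hu)
    · exact hw (hT u w d h hwd hbd hu)
    · exact hw (hT u w a h hwa had.symm hu)

lemma Dia.entry' {u w : V} (hu : ¬ InDia G u) (h : G.Adj u w)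
    (hd : InDia G w) : ∃ b c d b', Dia G w b c d u b' := by
  obtain ⟨a, b, c, d, a', b', h1, rfl | rfl⟩ := hd
  · rcases (h1.ha.adj u).1 h.symm with rfl | rfl | rfl
    · exact absurd h1.inC hu
    · exact absurd h1.inD hu
    · exact ⟨b, c, d, b', h1⟩
  · exfalso
    rcases (h1.hc.adj u).1 h.symm with rfl | rfl | rfl
    · exact hu h1.inA
    · exact hu h1.inB
    · exact hu h1.inD

section Fin
variable [Fintype V]

lemma exists_boundary (hconn : G.Connected) {T : Finset V} (hne : T.Nonempty) (hT : ∃ v, v ∉ T) :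
    ∃ u ∈ T, ∃ w, w ∉ T ∧ G.Adj u w := by
  obtain ⟨u, hu⟩ := hne
  obtain ⟨v, hv⟩ := hT
  obtain ⟨p⟩ := hconn.preconnected u v
  obtain ⟨d, -, h1, h2⟩ := p.exists_boundary_dart (T : Set V) (by simpa using hu) (by simpa using hv)
  exact ⟨d.fst, by simpa using h1, d.snd, by simpa using h2, d.adj⟩

open Classical in
/-- Triangle vertices touched by `T`. -/
noncomputable def W (G : SimpleGraph V) (T : Finset V) : Finset V :=
  Finset.univ.filter (fun v => v ∉ T ∧ ¬ InDia G v ∧ ∃ u ∈ T, G.Adj u v)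

lemma mem_W {T : Finset V} {v : V} : v ∈ W G T ↔ v ∉ T ∧ ¬ InDia G v ∧ ∃ u ∈ T, G.Adj u v := by
  simp [W]

structure St (G : SimpleGraph V) (S T : Finset V) : Prop where
  ne : T.Nonempty
  tc : TC G T
  tot : Tot G S
  reach : Reach G S T

variable [DecidableEq V]

lemma Dia.disj {T : Finset V} (hT : TC G T) {a b c d a' b' : V} (h : Dia G a b c d a' b')
    (ha : a ∉ T) : b ∉ T ∧ c ∉ T ∧ d ∉ T := by
  have hac : G.Adj a c := by simp [h.ha.adj]
  have had : G.Adj a d := by simp [h.ha.adj]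
  have hbc : G.Adj b c := by simp [h.hb.adj]
  have hbd : G.Adj b d := by simp [h.hb.adj]
  have hcd : G.Adj c d := by simp [h.hc.adj]
  have hc : c ∉ T := fun hh => ha (hT c a d hac.symm had hcd hh)
  have hd : d ∉ T := fun hh => ha (hT d a c had.symm hac hcd.symm hh)
  exact ⟨fun hh => hc (hT b c d hbc hcd hbd hh), hc, hd⟩

lemma Dia.card {a b c d a' b' : V} (h : Dia G a b c d a' b') : ({a, b, c, d} : Finset V).card = 4 := by
  have := h.hc.pq; have := h.hc.pr; have := h.hc.qr; have := h.hd.pr; have := h.hd.qr; have := h.ha.pq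
  rw [Finset.card_eq_succ]
  refine ⟨a, {b, c, d}, by simp [*], rfl, ?_⟩
  rw [Finset.card_eq_three]
  exact ⟨b, c, d, by assumption, by assumption, by assumption, rfl⟩

lemma Tri.card {x y z x' y' z' : V} (h : Tri G x y z x' y' z') : ({x, y, z} : Finset V).card = 3 := by
  rw [Finset.card_eq_three]
  exact ⟨x, y, z, h.hz.pq, h.hy.pq, h.hx.pq, rfl⟩

lemma Tri.disj {T : Finset V} (hT : TC G T) {x y z x' y' z' : V} (h : Tri G x y z x' y' z')
    (hx : x ∉ T) : y ∉ T ∧ z ∉ T := by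
  have hxy : G.Adj x y := by simp [h.hx.adj]
  have hxz : G.Adj x z := by simp [h.hx.adj]
  have hyz : G.Adj y z := by simp [h.hy.adj]
  exact ⟨fun hh => hx (hT y x z hxy.symm hxz hyz hh), fun hh => hx (hT z x y hxz.symm hxy hyz.symm hh)⟩

lemma Dia.disjoint {T : Finset V} (hT : TC G T) {a b c d a' b' : V} (h : Dia G a b c d a' b')
    (ha : a ∉ T) : Disjoint T {a, b, c, d} := by
  have := h.disj hT ha
  simp [ha, this]

lemma Tri.disjoint {T : Finset V} (hT : TC G T) {x y z x' y' z' : V} (h : Tri G x y z x' y' z')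
    (hx : x ∉ T) : Disjoint T {x, y, z} := by
  have := h.disj hT hx
  simp [hx, this]

/-- adding a touched diamond -/
lemma St.addDia (hcf : ClawFree G) (hc : IsCubic G) {S T : Finset V} (h : St G S T) {u w b c d b' : V}
    (hu : u ∈ T) (hw : w ∉ T) (hd : Dia G w b c d u b') :
    St G (S ∪ {c, d}) (T ∪ {w, b, c, d}) ∧ (S ∪ {c, d}).card ≤ S.card + 2 ∧
      (T ∪ {w, b, c, d}).card = T.card + 4 ∧ W G T ⊆ W G (T ∪ {w, b, c, d}) := by
  have hcd : G.Adj c d := by simp [hd.hc.adj]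
  refine ⟨⟨h.ne.mono Finset.subset_union_left, h.tc.union hd.tc, h.tot.union ?_, ?_⟩, ?_, ?_, ?_⟩
  · intro v hv
    simp only [Finset.mem_insert, Finset.mem_singleton] at hv
    rcases hv with rfl | rfl
    · exact ⟨d, by simp, hcd⟩
    · exact ⟨c, by simp, hcd.symm⟩
  · intro X hS hX
    have hTX := h.reach X (fun v hv => hS v (by simp [hv])) hX
    have wX : w ∈ X := h.tc.frontier hcf hc hX hTX hu (by rw [G.adj_comm]; simp [hd.ha.adj])
    have cX : c ∈ X := hS c (by simp)
    have dX : d ∈ X := hS d (by simp)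
    have bX : b ∈ X := force hX hd.hc.perm2 cX wX dX
    intro v hv
    simp only [Finset.mem_union, Finset.mem_insert, Finset.mem_singleton] at hv
    rcases hv with hv | rfl | rfl | rfl | rfl
    · exact hTX v hv
    all_goals assumption
  · exact (Finset.card_union_le _ _).trans (by rw [Finset.card_pair hcd.ne])
  · rw [Finset.card_union_of_disjoint (hd.disjoint h.tc hw), hd.card]
  · intro v hv
    rw [mem_W] at hv ⊢
    obtain ⟨h1, h2, u, h3, h4⟩ := hv
    refine ⟨?_, h2, u, by simp [h3], h4⟩
    simp only [Finset.mem_union, Finset.mem_insert, Finset.mem_singleton]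
    have := hd.inA; have := hd.inB; have := hd.inC; have := hd.inD
    rintro (hv | rfl | rfl | rfl | rfl) <;> contradiction

lemma step (hconn : G.Connected) (hcf : ClawFree G) (hc : IsCubic G) (hK : NoK4 G) {S T : Finset V}
    (h : St G S T) (hJ : 2 * S.card < T.card + (W G T).card) (hT : ∃ v, v ∉ T) :
    ∃ S' T', St G S' T' ∧ 2 * S'.card < T'.card + (W G T').card ∧ T.card < T'.card := by
  by_cases hD : ∃ u ∈ T, ∃ w, w ∉ T ∧ G.Adj u w ∧ InDia G w
  · obtain ⟨u, hu, w, hw, huw, hwd⟩ := hD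
    obtain ⟨b, c, d, b', hd⟩ := Dia.entry h.tc hu hw huw hwd
    obtain ⟨h1, h2, h3, h4⟩ := h.addDia hcf hc hu hw hd
    have := Finset.card_le_card h4
    exact ⟨_, _, h1, by omega, by omega⟩
  obtain ⟨u, hu, x, hx, hux⟩ := exists_boundary hconn h.ne hT
  have hxd : ¬ InDia G x := fun hh => hD ⟨u, hu, x, hx, hux, hh⟩
  obtain ⟨y, z, x', y', z', ht⟩ := Tri.exists hcf hc hxd
  have hdis := ht.disj h.tc hx
  obtain rfl : u = x' := by
    rcases (ht.hx.adj u).1 hux.symm with rfl | rfl | rfl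
    · exact absurd hu hdis.1
    · exact absurd hu hdis.2
    · rfl
  have hyy : G.Adj y y' := by simp [ht.hy.adj]
  have hzz : G.Adj z z' := by simp [ht.hz.adj]
  have hyz : G.Adj y z := by simp [ht.hy.adj]
  have hcard : (T ∪ {x, y, z}).card = T.card + 3 := by
    rw [Finset.card_union_of_disjoint (ht.disjoint h.tc hx), ht.card]
  -- a triangle touched twice
  have two : ∀ {y z y' z' : V}, Tri G x y z u y' z' → (T ∪ {x, y, z}).card = T.card + 3 → y' ∈ T →
    ∃ S' T', St G S' T' ∧ 2 * S'.card < T'.card + (W G T').card ∧ T.card < T'.card := by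
    intro y z y' z' ht hcard hy'
    have hyy : G.Adj y y' := by simp [ht.hy.adj]
    refine ⟨S, T ∪ {x, y, z}, ⟨h.ne.mono Finset.subset_union_left, h.tc.union (ht.tc hc hK), h.tot, ?_⟩, ?_, by omega⟩
    · intro X hS hX
      have hTX := h.reach X hS hX
      have xX : x ∈ X := h.tc.frontier hcf hc hX hTX hu hux
      have yX : y ∈ X := h.tc.frontier hcf hc hX hTX hy' hyy.symm
      have zX : z ∈ X := force hX ht.hx.perm2 xX yX (hTX u hu)
      intro v hv
      simp only [Finset.mem_union, Finset.mem_insert, Finset.mem_singleton] at hv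
      rcases hv with hv | rfl | rfl | rfl
      · exact hTX v hv
      all_goals assumption
    · have : W G T \ {x, y, z} ⊆ W G (T ∪ {x, y, z}) := by
        intro v hv
        rw [Finset.mem_sdiff, mem_W] at hv
        obtain ⟨⟨h1, h2, t, h3, h4⟩, h5⟩ := hv
        rw [mem_W]
        exact ⟨by simp only [Finset.mem_union]; tauto, h2, t, by simp [h3], h4⟩
      have h1 := Finset.card_le_card this
      have h2 := Finset.le_card_sdiff {x, y, z} (W G T)
      rw [ht.card] at h2
      omega
  by_cases hy' : y' ∈ T
  · exact two ht hcard hy'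
  by_cases hz' : z' ∈ T
  · refine two ht.swap ?_ hz'
    rw [← hcard]; congr 2; ext v; simp; tauto
  have o1 := ht.out hc hK
  have o2 := ht.rot.out hc hK
  have o3 := ht.swap.rot.out hc hK
  have notW : ∀ {v t : V}, v ∈ W G T → t ∉ T → ¬ InDia G t → ¬ (G.Adj v t ∧ v ∉ ({x, y, z} : Finset V) ∧ t ∈ ({x, y, z} : Finset V)) := by
    rintro v t hv ht1 ht2 ⟨h1, h2, h3⟩
    rw [mem_W] at hv
    obtain ⟨hv1, hv2, s, hs, hsv⟩ := hv
    have := (h.tc.union (ht.tc hc hK)).uniq hcf hc (u := s) (u' := t) (w := v) (by simp [hs])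
      (Finset.mem_union_right _ h3) (by simp only [Finset.mem_union]; tauto) hsv h1.symm
    exact ht1 (this ▸ hs)
  -- attaching a triangle together with a diamond
  have tdia : ∀ {y z y' z' : V}, Tri G x y z u y' z' → (T ∪ {x, y, z}).card = T.card + 3 → y' ∉ T →
      z ∉ T → y ∉ T → z' ∉ T → InDia G y' →
    ∃ S' T', St G S' T' ∧ 2 * S'.card < T'.card + (W G T').card ∧ T.card < T'.card := by
    intro y z a z' ht hcard ha hzT hyT hzT' hin
    have hya : G.Adj y a := by simp [ht.hy.adj]
    obtain ⟨b, c, d, b', hd⟩ := Dia.entry' ht.ny hya hin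
    have hac : G.Adj a c := by simp [hd.ha.adj]
    have ha' : a ∉ T ∪ {x, y, z} := by
      simp only [Finset.mem_union, Finset.mem_insert, Finset.mem_singleton]
      have := ht.nx; have := ht.ny; have := ht.nz
      rintro (h | rfl | rfl | rfl) <;> contradiction
    have tc1 := h.tc.union (ht.tc hc hK)
    have hcard2 : (T ∪ {x, y, z} ∪ {a, b, c, d}).card = T.card + 7 := by
      rw [Finset.card_union_of_disjoint (hd.disjoint tc1 ha'), hd.card]; omega
    refine ⟨S ∪ {y, a, c}, T ∪ {x, y, z} ∪ {a, b, c, d},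
      ⟨h.ne.mono (by intro v; simp; tauto), tc1.union hd.tc, h.tot.union ?_, ?_⟩, ?_, by omega⟩
    · intro v hv
      simp only [Finset.mem_insert, Finset.mem_singleton] at hv
      rcases hv with rfl | rfl | rfl
      · exact ⟨a, by simp, hya⟩
      · exact ⟨y, by simp, hya.symm⟩
      · exact ⟨a, by simp, hac.symm⟩
    · intro X hS hX
      have hTX := h.reach X (fun v hv => hS v (by simp [hv])) hX
      have xX : x ∈ X := h.tc.frontier hcf hc hX hTX hu hux
      have yX : y ∈ X := hS y (by simp)
      have aX : a ∈ X := hS a (by simp)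
      have cX : c ∈ X := hS c (by simp)
      have zX : z ∈ X := force hX ht.hx.perm2 xX yX (hTX u hu)
      have dX : d ∈ X := force hX hd.ha.perm2 aX cX yX
      have bX : b ∈ X := force hX hd.hc.perm2 cX aX dX
      intro v hv
      simp only [Finset.mem_union, Finset.mem_insert, Finset.mem_singleton] at hv
      rcases hv with (hv | rfl | rfl | rfl) | rfl | rfl | rfl | rfl
      · exact hTX v hv
      all_goals assumption
    · have : W G T \ {x} ⊆ W G (T ∪ {x, y, z} ∪ {a, b, c, d}) := by
        intro v hv
        rw [Finset.mem_sdiff, mem_W] at hv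
        obtain ⟨⟨h1, h2, t, h3, h4⟩, h5⟩ := hv
        rw [mem_W]
        refine ⟨?_, h2, t, by simp [h3], h4⟩
        simp only [Finset.mem_union, Finset.mem_insert, Finset.mem_singleton]
        have := hd.inA; have := hd.inB; have := hd.inC; have := hd.inD
        rintro ((hv | rfl | rfl | rfl) | rfl | rfl | rfl | rfl) <;> try contradiction
        · simp at h5
        · rcases (ht.hy.adj t).1 h4.symm with rfl | rfl | rfl <;> contradiction
        · rcases (ht.hz.adj t).1 h4.symm with rfl | rfl | rfl <;> contradiction
      have h1 := Finset.card_le_card this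
      have h2 := Finset.le_card_sdiff {x} (W G T)
      rw [Finset.card_singleton] at h2
      have h3 := (Finset.card_union_le S {y, a, c})
      have h4 := Finset.card_le_three (a := y) (b := a) (c := c)
      omega
  by_cases iy : InDia G y'
  · exact tdia ht hcard hy' hdis.2 hdis.1 hz' iy
  by_cases iz : InDia G z'
  · refine tdia ht.swap ?_ hz' hdis.1 hdis.2 hy' iz
    rw [← hcard]; congr 2; ext v; simp; tauto
  refine ⟨S ∪ {y, z}, T ∪ {x, y, z}, ⟨h.ne.mono Finset.subset_union_left, h.tc.union (ht.tc hc hK), h.tot.union ?_, ?_⟩, ?_, by omega⟩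
  · intro v hv
    simp only [Finset.mem_insert, Finset.mem_singleton] at hv
    rcases hv with rfl | rfl
    · exact ⟨z, by simp, hyz⟩
    · exact ⟨y, by simp, hyz.symm⟩
  · intro X hS hX
    have hTX := h.reach X (fun v hv => hS v (by simp [hv])) hX
    have xX : x ∈ X := h.tc.frontier hcf hc hX hTX hu hux
    have yX : y ∈ X := hS y (by simp)
    have zX : z ∈ X := hS z (by simp)
    intro v hv
    simp only [Finset.mem_union, Finset.mem_insert, Finset.mem_singleton] at hv
    rcases hv with hv | rfl | rfl | rfl
    · exact hTX v hv
    all_goals assumption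
  · have ny : y' ∉ W G T := fun hh => notW hh hdis.1 ht.ny ⟨hyy.symm, by simp; tauto, by simp⟩
    have nz : z' ∉ W G T := fun hh => notW hh hdis.2 ht.nz ⟨hzz.symm, by simp; tauto, by simp⟩
    have hsub : insert y' (insert z' (W G T \ {x})) ⊆ W G (T ∪ {x, y, z}) := by
      intro v hv
      rw [Finset.mem_insert, Finset.mem_insert, Finset.mem_sdiff, mem_W] at hv
      rw [mem_W]
      rcases hv with rfl | rfl | ⟨⟨h1, h2, t, h3, h4⟩, h5⟩
      · exact ⟨by simp; tauto, iy, y, by simp, hyy⟩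
      · exact ⟨by simp; tauto, iz, z, by simp, hzz⟩
      · refine ⟨?_, h2, t, by simp [h3], h4⟩
        simp only [Finset.mem_union, Finset.mem_insert, Finset.mem_singleton]
        rintro (hv | rfl | rfl | rfl) <;> try contradiction
        · simp at h5
        · rcases (ht.hy.adj t).1 h4.symm with rfl | rfl | rfl <;> tauto
        · rcases (ht.hz.adj t).1 h4.symm with rfl | rfl | rfl <;> tauto
    have h1 := Finset.card_le_card hsub
    rw [Finset.card_insert_of_notMem (by simp; tauto), Finset.card_insert_of_notMem (by simp; tauto)] at h1
    have h2 := Finset.le_card_sdiff {x} (W G T)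
    rw [Finset.card_singleton] at h2
    have h3 := (Finset.card_union_le S {y, z})
    have h4 := Finset.card_le_two (a := y) (b := z)
    omega

lemma finish (hconn : G.Connected) (hcf : ClawFree G) (hc : IsCubic G) (hK : NoK4 G) :
    ∀ (n : ℕ) {S T : Finset V}, Fintype.card V - T.card = n → 
    St G S T → 2 * S.card < T.card + (W G T).card →
    ∃ S' : Finset V, IsTotalForcingSet G (S' : Set V) ∧ 2 * S'.card < Fintype.card V := by
  intro n
  induction n using Nat.strong_induction_on with
  | _ n ih =>
  intro S T hn h hJ
  by_cases hT : ∃ v, v ∉ T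
  · obtain ⟨S', T', h1, h2, h3⟩ := step hconn hcf hc hK h hJ hT
    have := Finset.card_le_univ T'
    exact ih _ (by omega) rfl h1 h2
  · push Not at hT
    refine ⟨S, ⟨?_, ?_⟩, ?_⟩
    · intro X hX hF v
      exact h.reach X (fun v hv => hX (by simpa using hv)) hF v (hT v)
    · intro v hv
      obtain ⟨w, hw, e⟩ := h.tot v (by simpa using hv)
      exact ⟨w, by simpa using hw, e⟩
    · have hW : W G T = ∅ := by
        rw [Finset.eq_empty_iff_forall_notMem]
        intro v hv
        exact (mem_W.1 hv).1 (hT v)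
      rw [hW, Finset.card_empty] at hJ
      have := Finset.card_le_univ T
      omega

def JJ (G : SimpleGraph V) : Prop :=
  ∃ S T : Finset V, St G S T ∧ 2 * S.card < T.card + (W G T).card

lemma St.full {S T : Finset V} (h : St G S T) (hT : ∀ v, v ∈ T) : IsTotalForcingSet G (S : Set V) := by
  refine ⟨?_, ?_⟩
  · intro X hX hF v
    exact h.reach X (fun v hv => hX (by simpa using hv)) hF v (hT v)
  · intro v hv
    obtain ⟨w, hw, e⟩ := h.tot v (by simpa using hv)
    exact ⟨w, by simpa using hw, e⟩

lemma sat (hconn : G.Connected) (hcf : ClawFree G) (hc : IsCubic G) :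
    ∀ (n : ℕ) {S T : Finset V}, Fintype.card V - T.card = n → 
    St G S T → (∀ v ∈ T, InDia G v) → 2 * S.card ≤ T.card →
    JJ G ∨ ((∀ v, InDia G v) ∧ ∃ S' : Finset V, IsTotalForcingSet G (S' : Set V) ∧
      2 * S'.card ≤ Fintype.card V) := by
  intro n
  induction n using Nat.strong_induction_on with
  | _ n ih =>
  intro S T hn h hD hJ
  by_cases hT : ∃ v, v ∉ T
  · obtain ⟨u, hu, w, hw, huw⟩ := exists_boundary hconn h.ne hT
    by_cases hwd : InDia G w
    · obtain ⟨b, c, d, b', hd⟩ := Dia.entry h.tc hu hw huw hwd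
      obtain ⟨h1, h2, h3, h4⟩ := h.addDia hcf hc hu hw hd
      have := Finset.card_le_univ (T ∪ {w, b, c, d})
      refine ih _ (by omega) rfl h1 ?_ (by omega)
      intro v hv
      simp only [Finset.mem_union, Finset.mem_insert, Finset.mem_singleton] at hv
      rcases hv with hv | rfl | rfl | rfl | rfl
      · exact hD v hv
      · exact hd.inA
      · exact hd.inB
      · exact hd.inC
      · exact hd.inD
    · left
      refine ⟨S, T, h, ?_⟩
      have : 0 < (W G T).card := Finset.card_pos.2 ⟨w, mem_W.2 ⟨hw, hwd, u, hu, huw⟩⟩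
      omega
  · push Not at hT
    right
    refine ⟨fun v => hD v (hT v), S, h.full hT, ?_⟩
    have := Finset.card_le_univ T
    omega

lemma Dia.outA {a b c d a' b' : V} (h : Dia G a b c d a' b') : a' ≠ a ∧ a' ≠ b ∧ a' ≠ c ∧ a' ≠ d := by
  have haa : G.Adj a a' := by simp [h.ha.adj]
  exact ⟨haa.ne', fun e => h.nab (e ▸ haa), h.ha.pr.symm, h.ha.qr.symm⟩

lemma startDD (hconn : G.Connected) (hcf : ClawFree G) (hc : IsCubic G) {a b c d e b' : V}
    (h : Dia G a b c d e b') (he : InDia G e) :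
    JJ G ∨ ((∀ v, InDia G v) ∧ ∃ S' : Finset V, IsTotalForcingSet G (S' : Set V) ∧
      2 * S'.card ≤ Fintype.card V) := by
  have o := h.outA
  have hae : G.Adj a e := by simp [h.ha.adj]
  have he' : e ∉ ({a, b, c, d} : Finset V) := by simp [o]
  obtain ⟨f, g, k, f', h2⟩ := Dia.entry h.tc (u := a) (by simp) he' hae he
  have hac : G.Adj a c := by simp [h.ha.adj]
  have heg : G.Adj e g := by simp [h2.ha.adj]
  have hcard : (({a, b, c, d} : Finset V) ∪ {e, f, g, k}).card = 8 := by
    rw [Finset.card_union_of_disjoint (h2.disjoint h.tc he'), h.card, h2.card]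
  have hS : ({c, a, e, g} : Finset V).card ≤ 4 := Finset.card_le_four
  refine sat hconn hcf hc _ (S := {c, a, e, g}) rfl
    ⟨⟨a, by simp⟩, h.tc.union h2.tc, ?_, ?_⟩ ?_ (hcard ▸ by omega)
  · intro v hv
    simp only [Finset.mem_insert, Finset.mem_singleton] at hv
    rcases hv with rfl | rfl | rfl | rfl
    · exact ⟨a, by simp, hac.symm⟩
    · exact ⟨c, by simp, hac⟩
    · exact ⟨g, by simp, heg⟩
    · exact ⟨e, by simp, heg.symm⟩
  · intro X hS hX
    have aX : a ∈ X := hS a (by simp)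
    have cX : c ∈ X := hS c (by simp)
    have eX : e ∈ X := hS e (by simp)
    have gX : g ∈ X := hS g (by simp)
    have dX : d ∈ X := force hX h.ha.perm2 aX cX eX
    have bX : b ∈ X := force hX h.hc.perm2 cX aX dX
    have kX : k ∈ X := force hX h2.ha.perm2 eX gX aX
    have fX : f ∈ X := force hX h2.hc.perm2 gX eX kX
    intro v hv
    simp only [Finset.mem_union, Finset.mem_insert, Finset.mem_singleton] at hv
    rcases hv with (rfl | rfl | rfl | rfl) | rfl | rfl | rfl | rfl <;> assumption
  · intro v hv
    simp only [Finset.mem_union, Finset.mem_insert, Finset.mem_singleton] at hv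
    rcases hv with (rfl | rfl | rfl | rfl) | rfl | rfl | rfl | rfl
    · exact h.inA
    · exact h.inB
    · exact h.inC
    · exact h.inD
    · exact h2.inA
    · exact h2.inB
    · exact h2.inC
    · exact h2.inD

/-- a diamond with both ends attached to the same triangle -/
lemma startLoop (hc : IsCubic G) (hK : NoK4 G) {x y z y' z' a b c d : V}
    (ht : Tri G x y z a y' z') (h : Dia G a b c d x y) : JJ G := by
  have hax : G.Adj a x := by simp [h.ha.adj]
  have hac : G.Adj a c := by simp [h.ha.adj]
  have ha : a ∉ ({x, y, z} : Finset V) := by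
    have := ht.out hc hK
    simp; tauto
  have hcard : (({x, y, z} : Finset V) ∪ {a, b, c, d}).card = 7 := by
    rw [Finset.card_union_of_disjoint (h.disjoint (ht.tc hc hK) ha), h.card, ht.card]
  have hS : ({x, a, c} : Finset V).card ≤ 3 := Finset.card_le_three
  refine ⟨{x, a, c}, _, ⟨⟨x, by simp⟩, (ht.tc hc hK).union h.tc, ?_, ?_⟩, (hcard ▸ by omega)⟩
  · intro v hv
    simp only [Finset.mem_insert, Finset.mem_singleton] at hv
    rcases hv with rfl | rfl | rfl
    · exact ⟨a, by simp, hax.symm⟩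
    · exact ⟨c, by simp, hac⟩
    · exact ⟨a, by simp, hac.symm⟩
  · intro X hS hX
    have aX : a ∈ X := hS a (by simp)
    have cX : c ∈ X := hS c (by simp)
    have xX : x ∈ X := hS x (by simp)
    have dX : d ∈ X := force hX h.ha.perm2 aX cX xX
    have bX : b ∈ X := force hX h.hc.perm2 cX aX dX
    have yX : y ∈ X := force hX h.hb bX cX dX
    have zX : z ∈ X := force hX ht.hx.perm2 xX yX aX
    intro v hv
    simp only [Finset.mem_union, Finset.mem_insert, Finset.mem_singleton] at hv
    rcases hv with (rfl | rfl | rfl) | rfl | rfl | rfl | rfl <;> assumption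

/-- triangle and diamond, with a second triangle exit -/
lemma startTD (hcf : ClawFree G) (hc : IsCubic G) (hK : NoK4 G) {x y z y' z' a b c d b' : V}
    (ht : Tri G x y z a y' z') (h : Dia G a b c d x b') (hb' : ¬ InDia G b')
    (hbA : b' ∉ ({x, y, z} : Finset V)) (hy : ¬ InDia G y') : JJ G := by
  have hax : G.Adj a x := by simp [h.ha.adj]
  have hac : G.Adj a c := by simp [h.ha.adj]
  have hxy : G.Adj x y := by simp [ht.hx.adj]
  have hyy : G.Adj y y' := by simp [ht.hy.adj]
  have hbb : G.Adj b b' := by simp [h.hb.adj]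
  have ha : a ∉ ({x, y, z} : Finset V) := by
    have := ht.out hc hK
    simp; tauto
  have o2 := ht.rot.out hc hK
  have hcard : (({x, y, z} : Finset V) ∪ {a, b, c, d}).card = 7 := by
    rw [Finset.card_union_of_disjoint (h.disjoint (ht.tc hc hK) ha), h.card, ht.card]
  have hS : ({y, x, a, c} : Finset V).card ≤ 4 := Finset.card_le_four
  have tc := (ht.tc hc hK).union h.tc
  have iA := h.inA
  have iB := h.inB
  have iC := h.inC
  have iD := h.inD
  have hyT : y' ∉ ({x, y, z} : Finset V) ∪ {a, b, c, d} := by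
    simp only [Finset.mem_union, Finset.mem_insert, Finset.mem_singleton]
    rintro ((e | e | e) | rfl | rfl | rfl | rfl) <;> tauto
  have hbT : b' ∉ ({x, y, z} : Finset V) ∪ {a, b, c, d} := by
    rw [Finset.mem_union, not_or]
    refine ⟨hbA, ?_⟩
    simp only [Finset.mem_insert, Finset.mem_singleton]
    rintro (rfl | rfl | rfl | rfl) <;> tauto
  have hne : y' ≠ b' := by
    intro e
    have := tc.uniq hcf hc (u := y) (u' := b) (w := y') (by simp) (by simp) hyT hyy (e ▸ hbb)
    exact ht.ny (this ▸ iB)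
  have hsub : ({y', b'} : Finset V) ⊆ W G (({x, y, z} : Finset V) ∪ {a, b, c, d}) := by
    intro v hv
    simp only [Finset.mem_insert, Finset.mem_singleton] at hv
    rcases hv with rfl | rfl
    · exact mem_W.2 ⟨hyT, hy, y, by simp, hyy⟩
    · exact mem_W.2 ⟨hbT, hb', b, by simp, hbb⟩
  have h2 := Finset.card_le_card hsub
  rw [Finset.card_pair hne] at h2
  refine ⟨{y, x, a, c}, _, ⟨⟨x, by simp⟩, tc, ?_, ?_⟩, (hcard ▸ by omega)⟩
  · intro v hv
    simp only [Finset.mem_insert, Finset.mem_singleton] at hv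
    rcases hv with rfl | rfl | rfl | rfl
    · exact ⟨x, by simp, hxy.symm⟩
    · exact ⟨a, by simp, hax.symm⟩
    · exact ⟨c, by simp, hac⟩
    · exact ⟨a, by simp, hac.symm⟩
  · intro X hS hX
    have aX : a ∈ X := hS a (by simp)
    have cX : c ∈ X := hS c (by simp)
    have xX : x ∈ X := hS x (by simp)
    have yX : y ∈ X := hS y (by simp)
    have dX : d ∈ X := force hX h.ha.perm2 aX cX xX
    have bX : b ∈ X := force hX h.hc.perm2 cX aX dX
    have zX : z ∈ X := force hX ht.hx.perm2 xX yX aX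
    intro v hv
    simp only [Finset.mem_union, Finset.mem_insert, Finset.mem_singleton] at hv
    rcases hv with (rfl | rfl | rfl) | rfl | rfl | rfl | rfl <;> assumption

/-- triangle with two diamonds -/
lemma startTDD (hcf : ClawFree G) (hc : IsCubic G) (hK : NoK4 G) {x y z z' a b c d b' e f g k f' : V}
    (ht : Tri G x y z a e z') (h : Dia G a b c d x b') (hb' : ¬ InDia G b')
    (hbA : b' ∉ ({x, y, z} : Finset V)) (h2 : Dia G e f g k y f') (hf' : ¬ InDia G f')
    (hfA : f' ∉ ({x, y, z} : Finset V)) : JJ G := by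
  have hax : G.Adj a x := by simp [h.ha.adj]
  have hac : G.Adj a c := by simp [h.ha.adj]
  have heg : G.Adj e g := by simp [h2.ha.adj]
  have hxy : G.Adj x y := by simp [ht.hx.adj]
  have hey : G.Adj e y := by simp [h2.ha.adj]
  have hbb : G.Adj b b' := by simp [h.hb.adj]
  have hff : G.Adj f f' := by simp [h2.hb.adj]
  have o1 := ht.out hc hK
  have ha : a ∉ ({x, y, z} : Finset V) := by
    simp; tauto
  have o2 := ht.rot.out hc hK
  have iA := h.inA
  have iB := h.inB
  have iC := h.inC
  have iD := h.inD
  have iE := h2.inA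
  have iF := h2.inB
  have iG := h2.inC
  have iK := h2.inD
  have tc := (ht.tc hc hK).union h.tc
  have nx := ht.nx
  have ny := ht.ny
  have nz := ht.nz
  have he : e ∉ ({x, y, z} : Finset V) ∪ {a, b, c, d} := by
    simp only [Finset.mem_union, Finset.mem_insert, Finset.mem_singleton]
    rintro ((e | e | e) | rfl | rfl | rfl | rfl)
    · tauto
    · tauto
    · tauto
    · tauto
    · rcases (h.hb.adj y).1 hey with rfl | rfl | rfl
      · exact ny iC
      · exact ny iD
      · simp at hbA
    · rcases (h.hc.adj y).1 hey with rfl | rfl | rfl <;> contradiction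
    · rcases (h.hd.adj y).1 hey with rfl | rfl | rfl <;> contradiction
  have hdisj := h2.disj tc he
  have hcard : (({x, y, z} : Finset V) ∪ {a, b, c, d} ∪ {e, f, g, k}).card = 11 := by
    rw [Finset.card_union_of_disjoint (h2.disjoint tc he),
      Finset.card_union_of_disjoint (h.disjoint (ht.tc hc hK) ha), h.card, ht.card, h2.card]
  have hS : ({y, x, a, c, e, g} : Finset V).card ≤ 6 := Finset.card_le_six
  have tc2 := tc.union h2.tc
  have hT : ∀ v, ¬ InDia G v → v ∉ ({x, y, z} : Finset V) →
      v ∉ ({x, y, z} : Finset V) ∪ {a, b, c, d} ∪ {e, f, g, k} := by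
    intro v hv hv'
    rw [Finset.mem_union, Finset.mem_union, or_assoc, not_or]
    refine ⟨hv', ?_⟩
    simp only [Finset.mem_insert, Finset.mem_singleton]
    rintro ((rfl | rfl | rfl | rfl) | rfl | rfl | rfl | rfl) <;> contradiction
  have hbT := hT b' hb' hbA
  have hfT := hT f' hf' hfA
  have hne : b' ≠ f' := by
    intro e
    have := tc2.uniq hcf hc (u := b) (u' := f) (w := b') (by simp) (by simp) hbT hbb (e ▸ hff)
    subst this
    exact hdisj.1 (by simp)
  have hsub : ({b', f'} : Finset V) ⊆ W G (({x, y, z} : Finset V) ∪ {a, b, c, d} ∪ {e, f, g, k}) := by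
    intro v hv
    simp only [Finset.mem_insert, Finset.mem_singleton] at hv
    rcases hv with rfl | rfl
    · exact mem_W.2 ⟨hbT, hb', b, by simp, hbb⟩
    · exact mem_W.2 ⟨hfT, hf', f, by simp, hff⟩
  have h3 := Finset.card_le_card hsub
  rw [Finset.card_pair hne] at h3
  refine ⟨{y, x, a, c, e, g}, _, ⟨⟨x, by simp⟩, tc2, ?_, ?_⟩, (hcard ▸ by omega)⟩
  · intro v hv
    simp only [Finset.mem_insert, Finset.mem_singleton] at hv
    rcases hv with rfl | rfl | rfl | rfl | rfl | rfl
    · exact ⟨x, by simp, hxy.symm⟩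
    · exact ⟨a, by simp, hax.symm⟩
    · exact ⟨c, by simp, hac⟩
    · exact ⟨a, by simp, hac.symm⟩
    · exact ⟨g, by simp, heg⟩
    · exact ⟨e, by simp, heg.symm⟩
  · intro X hS hX
    have aX : a ∈ X := hS a (by simp)
    have cX : c ∈ X := hS c (by simp)
    have xX : x ∈ X := hS x (by simp)
    have yX : y ∈ X := hS y (by simp)
    have eX : e ∈ X := hS e (by simp)
    have gX : g ∈ X := hS g (by simp)
    have dX : d ∈ X := force hX h.ha.perm2 aX cX xX
    have bX : b ∈ X := force hX h.hc.perm2 cX aX dX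
    have kX : k ∈ X := force hX h2.ha.perm2 eX gX yX
    have fX : f ∈ X := force hX h2.hc.perm2 gX eX kX
    have zX : z ∈ X := force hX ht.hx.perm2 xX yX aX
    intro v hv
    simp only [Finset.mem_union, Finset.mem_insert, Finset.mem_singleton] at hv
    rcases hv with ((rfl | rfl | rfl) | rfl | rfl | rfl | rfl) | rfl | rfl | rfl | rfl <;> assumption

/-- identify outer neighbours -/
lemma Tri.out_eq {x y z x' y' z' a : V} (ht : Tri G x y z x' y' z') (h : G.Adj x a)
    (ha : InDia G a) : x' = a := by
  rcases (ht.hx.adj a).1 h with rfl | rfl | rfl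
  · exact absurd ha ht.ny
  · exact absurd ha ht.nz
  · rfl

/-- If there is a diamond -/
lemma startD (hconn : G.Connected) (hcf : ClawFree G) (hc : IsCubic G) (hK : NoK4 G)
    (hD : ∃ v, InDia G v) :
    JJ G ∨ ((∀ v, InDia G v) ∧ ∃ S' : Finset V, IsTotalForcingSet G (S' : Set V) ∧
      2 * S'.card ≤ Fintype.card V) := by
  by_cases hdd : ∃ a b c d a' b', Dia G a b c d a' b' ∧ InDia G a'
  · obtain ⟨a, b, c, d, a', b', h, h'⟩ := hdd
    exact startDD hconn hcf hc h h'
  left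
  by_cases hl : ∃ x y z y' z' a b c d, Tri G x y z a y' z' ∧ Dia G a b c d x y
  · obtain ⟨x, y, z, y', z', a, b, c, d, h, h'⟩ := hl
    exact startLoop hc hK h h'
  obtain ⟨_, a, b, c, d, x, b', h, -⟩ := hD
  have hx : ¬ InDia G x := fun e => hdd ⟨_, _, _, _, _, _, h, e⟩
  have hb' : ¬ InDia G b' := fun e => hdd ⟨_, _, _, _, _, _, h.swapE, e⟩
  obtain ⟨y, z, x', y', z', ht⟩ := Tri.exists hcf hc hx
  have hax : G.Adj a x := by simp [h.ha.adj]
  have hbb : G.Adj b b' := by simp [h.hb.adj]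
  obtain rfl := ht.out_eq hax.symm h.inA
  -- no loops at this triangle
  have nol : ∀ {x y z x' y' z' b c d b' : V}, Tri G x y z x' y' z' → Dia G x' b c d x b' →
      b' ∉ ({x, y, z} : Finset V) := by
    intro x y z x' y' z' b c d b' ht h hh
    have hbb : G.Adj b b' := by simp [h.hb.adj]
    simp only [Finset.mem_insert, Finset.mem_singleton] at hh
    rcases hh with rfl | rfl | rfl
    · have := ht.out_eq hbb.symm h.inB
      exact h.hc.pq this
    · exact hl ⟨_, _, _, _, _, _, _, _, _, ht, h⟩
    · exact hl ⟨_, _, _, _, _, _, _, _, _, ht.swap, h⟩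
  have hbA := nol ht h
  by_cases hy : InDia G y'
  · have hyy : G.Adj y y' := by simp [ht.hy.adj]
    obtain ⟨f, g, k, f', h2⟩ := Dia.entry' ht.ny hyy hy
    have hf' : ¬ InDia G f' := fun e => hdd ⟨_, _, _, _, _, _, h2.swapE, e⟩
    refine startTDD hcf hc hK ht h hb' hbA h2 hf' ?_
    have := nol ht.rot h2
    simp only [Finset.mem_insert, Finset.mem_singleton] at this ⊢
    tauto
  · exact startTD hcf hc hK ht h hb' hbA hy

lemma startTT (hcf : ClawFree G) (hc : IsCubic G) (hK : NoK4 G) (hD : ∀ v, ¬ InDia G v)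
    {x y z x' y' z' p q r s t : V} (ht : Tri G x y z x' y' z') (ht2 : Tri G x' p q s r t)
    (h1 : y' ∉ ({x', p, q} : Finset V)) (h2 : z' ∉ ({x', p, q} : Finset V)) : JJ G := by
  have hxx : G.Adj x x' := by simp [ht.hx.adj]
  have hxy : G.Adj x y := by simp [ht.hx.adj]
  have hyy : G.Adj y y' := by simp [ht.hy.adj]
  have hzz : G.Adj z z' := by simp [ht.hz.adj]
  have hxp : G.Adj x' p := by simp [ht2.hx.adj]
  have hpr : G.Adj p r := by simp [ht2.hy.adj]
  have o1 := ht.out hc hK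
  have o2 := ht.rot.out hc hK
  have o3 := ht.swap.rot.out hc hK
  have o4 := ht2.rot.out hc hK
  have tc1 := ht.tc hc hK
  have hx' : x' ∉ ({x, y, z} : Finset V) := by simp; tauto
  have tc := tc1.union (ht2.tc hc hK)
  have hcard : (({x, y, z} : Finset V) ∪ {x', p, q}).card = 6 := by
    rw [Finset.card_union_of_disjoint (ht2.disjoint tc1 hx'), ht.card, ht2.card]
  have hd := ht2.disj tc1 hx'
  simp only [Finset.mem_insert, Finset.mem_singleton, not_or] at h1 h2 hd hx'
  have hs : s = x := by
    rcases (ht2.hx.adj x).1 hxx.symm with e | e | e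
    · exact absurd e.symm hd.1.1
    · exact absurd e.symm hd.2.1
    · exact e.symm
  have hyT : y' ∉ ({x, y, z} : Finset V) ∪ {x', p, q} := by simp; tauto
  have hzT : z' ∉ ({x, y, z} : Finset V) ∪ {x', p, q} := by simp; tauto
  have hrT : r ∉ ({x, y, z} : Finset V) ∪ {x', p, q} := by
    simp only [Finset.mem_union, Finset.mem_insert, Finset.mem_singleton]
    rintro ((rfl | rfl | rfl) | e)
    · exact o4.2.2.2.1 hs.symm
    · rcases (ht.hy.adj p).1 hpr.symm with e | e | e
      · exact hd.1.1 e
      · exact hd.1.2.2 e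
      · exact h1.2.1 e.symm
    · rcases (ht.hz.adj p).1 hpr.symm with e | e | e
      · exact hd.1.1 e
      · exact hd.1.2.1 e
      · exact h2.2.1 e.symm
    · tauto
  have n1 : y' ≠ z' := o2.2.2.2.2
  have n2 : y' ≠ r := by
    intro e
    have := tc.uniq hcf hc (u := y) (u' := p) (w := y') (by simp) (by simp) hyT hyy (e ▸ hpr)
    exact hd.1.2.1 this.symm
  have n3 : z' ≠ r := by
    intro e
    have := tc.uniq hcf hc (u := z) (u' := p) (w := z') (by simp) (by simp) hzT hzz (e ▸ hpr)
    exact hd.1.2.2 this.symm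
  have hsub : ({y', z', r} : Finset V) ⊆ W G (({x, y, z} : Finset V) ∪ {x', p, q}) := by
    intro v hv
    simp only [Finset.mem_insert, Finset.mem_singleton] at hv
    rcases hv with rfl | rfl | rfl
    · exact mem_W.2 ⟨hyT, hD _, y, by simp, hyy⟩
    · exact mem_W.2 ⟨hzT, hD _, z, by simp, hzz⟩
    · exact mem_W.2 ⟨hrT, hD _, p, by simp, hpr⟩
  have h3 := Finset.card_le_card hsub
  rw [Finset.card_eq_three.2 ⟨_, _, _, n1, n2, n3, rfl⟩] at h3
  have hS : ({x, y, x', p} : Finset V).card ≤ 4 := Finset.card_le_four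
  refine ⟨{x, y, x', p}, _, ⟨⟨x, by simp⟩, tc, ?_, ?_⟩, (hcard ▸ by omega)⟩
  · intro v hv
    simp only [Finset.mem_insert, Finset.mem_singleton] at hv
    rcases hv with rfl | rfl | rfl | rfl
    · exact ⟨y, by simp, hxy⟩
    · exact ⟨x, by simp, hxy.symm⟩
    · exact ⟨p, by simp, hxp⟩
    · exact ⟨x', by simp, hxp.symm⟩
  · intro X hS hX
    have aX : x ∈ X := hS x (by simp)
    have bX : y ∈ X := hS y (by simp)
    have cX : x' ∈ X := hS x' (by simp)
    have dX : p ∈ X := hS p (by simp)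
    have eX : z ∈ X := force hX ht.hx.perm2 aX bX cX
    have fX : q ∈ X := force hX ht2.hx.perm2 cX dX (hs ▸ aX)
    intro v hv
    simp only [Finset.mem_union, Finset.mem_insert, Finset.mem_singleton] at hv
    rcases hv with (rfl | rfl | rfl) | rfl | rfl | rfl <;> assumption

/-- No diamonds: good start, or the explicit structure of the prism. -/
lemma startNoD (hconn : G.Connected) (hcf : ClawFree G) (hc : IsCubic G) (hK : NoK4 G)
    (hD : ∀ v, ¬ InDia G v) :
    JJ G ∨ ∃ x y z x' y' z', Tri G x y z x' y' z' ∧ Tri G x' y' z' x y z := by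
  obtain ⟨x⟩ := hconn.nonempty
  obtain ⟨y, z, x', y', z', ht⟩ := Tri.exists hcf hc (hD x)
  obtain ⟨p, q, s, r, t, ht2⟩ := Tri.exists hcf hc (hD x')
  have hxx : G.Adj x x' := by simp [ht.hx.adj]
  have hyy : G.Adj y y' := by simp [ht.hy.adj]
  have hzz : G.Adj z z' := by simp [ht.hz.adj]
  have o1 := ht.out hc hK
  have o2 := ht.rot.out hc hK
  have o3 := ht.swap.rot.out hc hK
  have tc2 := ht2.tc hc hK
  -- one of the other two edges avoids the second triangle but the other does not
  have mixed : ∀ {x y z x' y' z' : V}, Tri G x y z x' y' z' → x' ∈ ({x', p, q} : Finset V) →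
      ∀ {B : Finset V}, TC G B → x' ∈ B → y' ∈ B → z' ∉ B → JJ G := by
    intro x y z x' y' z' ht _ B hB hx hy hz
    obtain ⟨p, q, s, r, t, ht3⟩ := Tri.exists hcf hc (hD z')
    have := ht3.disj hB hz
    refine startTT hcf hc hK hD ht.swap.rot ht3 ?_ ?_
    · simp only [Finset.mem_insert, Finset.mem_singleton]
      rintro (rfl | rfl | rfl) <;> tauto
    · simp only [Finset.mem_insert, Finset.mem_singleton]
      rintro (rfl | rfl | rfl) <;> tauto
  by_cases h1 : y' ∈ ({x', p, q} : Finset V)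
  · by_cases h2 : z' ∈ ({x', p, q} : Finset V)
    · right
      have hx' : x' ∉ ({x, y, z} : Finset V) := by simp; tauto
      have hd := ht2.disj (ht.tc hc hK) hx'
      simp only [Finset.mem_insert, Finset.mem_singleton, not_or] at h1 h2 hd hx'
      have hs : s = x := by
        rcases (ht2.hx.adj x).1 hxx.symm with e | e | e
        · exact absurd e.symm hd.1.1
        · exact absurd e.symm hd.2.1
        · exact e.symm
      have key : ∀ {p q r t : V}, Tri G x' p q s r t → y' = p → z' = q →
          (p ≠ y ∧ p ≠ z ∧ q ≠ y ∧ q ≠ z) →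
          ∃ x y z x' y' z', Tri G x y z x' y' z' ∧ Tri G x' y' z' x y z := by
        rintro p q r t ht2 rfl rfl hd
        refine ⟨x, y, z, x', y', z', ht, ?_⟩
        have hr : r = y := by
          rcases (ht2.hy.adj y).1 hyy.symm with e | e | e
          · exact absurd e.symm hx'.2.1
          · exact absurd e.symm hd.2.2.1
          · exact e.symm
        have htz : t = z := by
          rcases (ht2.hz.adj z).1 hzz.symm with e | e | e
          · exact absurd e.symm hx'.2.2
          · exact absurd e.symm hd.2.1
          · exact e.symm
        subst hr htz hs
        exact ht2
      rcases h1 with e | e | e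
      · tauto
      · rcases h2 with e' | e' | e'
        · tauto
        · exact absurd (e.trans e'.symm) o2.2.2.2.2
        · exact key ht2 e e' (by tauto)
      · rcases h2 with e' | e' | e'
        · tauto
        · exact key ht2.swap e e' (by tauto)
        · exact absurd (e.trans e'.symm) o2.2.2.2.2
    · exact .inl (mixed ht (by simp) tc2 (by simp) h1 h2)
  · by_cases h2 : z' ∈ ({x', p, q} : Finset V)
    · exact .inl (mixed ht.swap (by simp) tc2 (by simp) h2 h1)
    · exact .inl (startTT hcf hc hK hD ht ht2 h1 h2)

lemma isoOf {U : Type*} [Nonempty U] (H : SimpleGraph U) (hconn : G.Connected) (φ : U → V)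
    (inj : Function.Injective φ) (adj : ∀ p q, G.Adj (φ p) (φ q) ↔ H.Adj p q)
    (cl : ∀ p w, G.Adj (φ p) w → ∃ q, φ q = w) : Nonempty (G ≃g H) := by
  have surj : Function.Surjective φ := by
    intro v
    by_contra hv
    obtain ⟨p⟩ := ‹Nonempty U›
    obtain ⟨w⟩ := hconn.preconnected (φ p) v
    obtain ⟨d, -, h1, h2⟩ := w.exists_boundary_dart (Set.range φ) ⟨p, rfl⟩ hv
    obtain ⟨q, hq⟩ := h1
    exact h2 (cl q d.snd (hq ▸ d.adj))
  let e : U ≃ V := Equiv.ofBijective φ ⟨inj, surj⟩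
  exact ⟨(⟨e, by intro a b; exact adj a b⟩ : H ≃g G).symm⟩

lemma noK4 (hconn : G.Connected) (hc : IsCubic G)
    (hK4 : ¬ Nonempty (G ≃g (⊤ : SimpleGraph (Fin 4)))) : NoK4 G := by
  intro a b c d ab ac ad bc bd cd
  apply hK4
  have key : ∀ {a b c d : V}, G.Adj a b → G.Adj a c → G.Adj a d → b ≠ c → b ≠ d → c ≠ d →
      ∀ w, G.Adj a w → w = b ∨ w = c ∨ w = d := by
    intro a b c d ab ac ad bc bd cd w hw
    obtain ⟨r, hr⟩ := Nb.third hc ab ac bc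
    have h1 := (hr.adj d).1 ad
    have h2 := (hr.adj w).1 hw
    grind
  have ka := key ab ac ad bc.ne bd.ne cd.ne
  have kb := key ab.symm bc bd ac.ne ad.ne cd.ne
  have kc := key ac.symm bc.symm cd ab.ne ad.ne bd.ne
  have kd := key ad.symm bd.symm cd.symm ab.ne ac.ne bc.ne
  refine isoOf _ hconn ![a, b, c, d] ?_ ?_ ?_
  · intro i j
    have := ab.ne; have := ac.ne; have := ad.ne; have := bc.ne; have := bd.ne; have := cd.ne
    fin_cases i <;> fin_cases j <;> simp [*] <;> tauto
  · intro i j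
    fin_cases i <;> fin_cases j <;> simp [ab, ac, ad, bc, bd, cd, ab.symm, ac.symm, ad.symm, bc.symm, bd.symm, cd.symm]
  · intro i w hw
    have : w = a ∨ w = b ∨ w = c ∨ w = d := by
      fin_cases i
      · have := ka w hw; tauto
      · have := kb w hw; tauto
      · have := kc w hw; tauto
      · have := kd w hw; tauto
    rcases this with rfl | rfl | rfl | rfl
    · exact ⟨0, rfl⟩
    · exact ⟨1, rfl⟩
    · exact ⟨2, rfl⟩
    · exact ⟨3, rfl⟩

lemma prism_adj (p q : Fin 3 × Fin 2) :
    prism.Adj p q ↔ (p.1 ≠ q.1 ∧ p.2 = q.2) ∨ (p.2 ≠ q.2 ∧ p.1 = q.1) := by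
  simp [prism, SimpleGraph.boxProd_adj, SimpleGraph.cycleGraph_three_eq_top]

lemma prism_case (hconn : G.Connected) (hc : IsCubic G) (hK : NoK4 G) {x y z x' y' z' : V}
    (h1 : Tri G x y z x' y' z') (h2 : Tri G x' y' z' x y z) :
    (∃ S' : Finset V, IsTotalForcingSet G (S' : Set V) ∧
      2 * S'.card ≤ Fintype.card V) ∧ Nonempty (G ≃g prism) := by
  have o1 := h1.out hc hK
  have o2 := h1.rot.out hc hK
  have o3 := h1.swap.rot.out hc hK
  have hx := h1.hx.adj
  have hy := h1.hy.adj
  have hz := h1.hz.adj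
  have hx' := h2.hx.adj
  have hy' := h2.hy.adj
  have hz' := h2.hz.adj
  have n1 := h1.hz.pq
  have n2 := h1.hy.pq
  have n3 := h1.hx.pq
  have iso : Nonempty (G ≃g prism) := by
    refine isoOf _ hconn (fun p => ![![x, y, z] p.1, ![x', y', z'] p.1] p.2) ?_ ?_ ?_
    · rintro ⟨i, j⟩ ⟨k, l⟩
      fin_cases i <;> fin_cases j <;> fin_cases k <;> fin_cases l <;> simp <;> grind
    · rintro ⟨i, j⟩ ⟨k, l⟩
      rw [prism_adj]
      fin_cases i <;> fin_cases j <;> fin_cases k <;> fin_cases l <;> simp [hx, hy, hz, hx', hy', hz'] <;> grind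
    · rintro ⟨i, j⟩ w hw
      have : w = x ∨ w = y ∨ w = z ∨ w = x' ∨ w = y' ∨ w = z' := by
        fin_cases i <;> fin_cases j <;> simp [hx, hy, hz, hx', hy', hz'] at hw <;> tauto
      rcases this with rfl | rfl | rfl | rfl | rfl | rfl
      · exact ⟨(0, 0), rfl⟩
      · exact ⟨(1, 0), rfl⟩
      · exact ⟨(2, 0), rfl⟩
      · exact ⟨(0, 1), rfl⟩
      · exact ⟨(1, 1), rfl⟩
      · exact ⟨(2, 1), rfl⟩
  refine ⟨⟨{x, y, z}, ⟨?_, ?_⟩, ?_⟩, iso⟩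
  · intro X hS hX
    have xX : x ∈ X := hS (by simp)
    have yX : y ∈ X := hS (by simp)
    have zX : z ∈ X := hS (by simp)
    have xX' : x' ∈ X := force hX h1.hx xX yX zX
    have yX' : y' ∈ X := force hX h1.hy yX xX zX
    have zX' : z' ∈ X := force hX h1.hz zX xX yX
    intro v
    by_contra hv
    obtain ⟨u, hu, w, hw, huw⟩ := exists_boundary hconn (T := {x, y, z, x', y', z'}) ⟨x, by simp⟩ ⟨v, by
      simp only [Finset.mem_insert, Finset.mem_singleton]
      rintro (rfl | rfl | rfl | rfl | rfl | rfl) <;> contradiction⟩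
    simp only [Finset.mem_insert, Finset.mem_singleton] at hu hw
    rcases hu with rfl | rfl | rfl | rfl | rfl | rfl
    · have := (hx w).1 huw; tauto
    · have := (hy w).1 huw; tauto
    · have := (hz w).1 huw; tauto
    · have := (hx' w).1 huw; tauto
    · have := (hy' w).1 huw; tauto
    · have := (hz' w).1 huw; tauto
  · intro v hv
    simp only [Finset.coe_insert, Finset.coe_singleton, Set.mem_insert_iff, Set.mem_singleton_iff] at hv
    rcases hv with rfl | rfl | rfl
    · exact ⟨y, by simp, by simp [hx]⟩
    · exact ⟨z, by simp, by simp [hy]⟩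
    · exact ⟨x, by simp, by simp [hz]⟩
  · obtain ⟨e⟩ := iso
    rw [Fintype.card_congr e.toEquiv, h1.card]
    simp

/-- lower bound for cubic graphs -/
lemma three_le (hc : IsCubic G) (hne : Nonempty V) (S : Finset V) (hS : IsTotalForcingSet G (S : Set V)) :
    3 ≤ S.card := by
  by_contra hlt
  have hfc : ForcingClosed G (S : Set V) := by
    intro v hv w hw hu
    by_contra hwS
    obtain ⟨s, hs, hvs⟩ := hS.2 v hv
    have hsw : s ≠ w := fun e => hwS (e ▸ hs)
    obtain ⟨r, hr⟩ := Nb.third hc hvs hw hsw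
    have hvr : G.Adj v r := by simp [hr.adj]
    have hrS : r ∈ S := by
      by_contra hrS
      exact hr.qr (hu r hvr (by simpa using hrS)).symm
    have : ({v, s, r} : Finset V) ⊆ S := by
      intro t ht
      simp only [Finset.mem_insert, Finset.mem_singleton] at ht
      rcases ht with rfl | rfl | rfl
      · simpa using hv
      · simpa using hs
      · exact hrS
    have := Finset.card_le_card this
    rw [Finset.card_eq_three.2 ⟨_, _, _, hvs.ne, hvr.ne, hr.pr, rfl⟩] at this
    omega
  have hall := hS.1 _ (le_refl _) hfc
  obtain ⟨v⟩ := hne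
  have h3 := hc v
  have := Set.ncard_le_ncard (s := G.neighborSet v) (t := (S : Set V)) (fun w _ => hall w)
  rw [h3, Set.ncard_coe_finset] at this
  omega

lemma IsTotalForcingSet.map {U : Type*} {H : SimpleGraph U} (e : G ≃g H) {S : Set V}
    (hS : IsTotalForcingSet G S) : IsTotalForcingSet H (e '' S) := by
  refine ⟨?_, ?_⟩
  · intro X hX hF v
    have := hS.1 (e ⁻¹' X) (fun s hs => hX ⟨s, hs, rfl⟩) ?_ (e.symm v)
    · simpa using this
    · intro v hv w hw hu
      refine hF (e v) hv (e w) (e.map_adj_iff.2 hw) ?_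
      intro u hu1 hu2
      have := hu (e.symm u) (by rw [← e.map_adj_iff]; simpa using hu1) (by simpa using hu2)
      rw [← this]; simp
  · rintro _ ⟨v, hv, rfl⟩
    obtain ⟨w, hw, h⟩ := hS.2 v hv
    exact ⟨e w, ⟨w, hw, rfl⟩, e.map_adj_iff.2 h⟩

lemma necklace_lower (k : ℕ) (S : Set (Fin k × Fin 4)) (hS : IsTotalForcingSet (diamondNecklace k) S) :
    2 * k ≤ S.ncard := by
  classical
  have hm : ∀ (i : Fin k) (q : Fin k × Fin 4) (m : Fin 4), m = 2 ∨ m = 3 →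
      ((diamondNecklace k).Adj q (i, m) ↔ q.1 = i ∧ q.2 ≠ m) := by
    rintro i ⟨j, n⟩ m hm
    simp only [diamondNecklace, SimpleGraph.fromRel_adj, Prod.mk.injEq, ne_eq]
    rcases hm with rfl | rfl <;> fin_cases n <;> simp <;> tauto
  have h1 : ∀ i : Fin k, (i, 2) ∈ S ∨ (i, 3) ∈ S := by
    intro i
    by_contra hcon
    push Not at hcon
    have := hS.1 {p | p ≠ (i, 2) ∧ p ≠ (i, 3)} ?_ ?_ (i, 2)
    · simp at this
    · intro p hp
      exact ⟨fun e => hcon.1 (e ▸ hp), fun e => hcon.2 (e ▸ hp)⟩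
    · rintro ⟨j, n⟩ hv w hw hu
      simp only [Set.mem_setOf_eq, ne_eq, Prod.mk.injEq] at hv
      by_contra hwS
      have hw' : w = (i, 2) ∨ w = (i, 3) := by
        simp only [Set.mem_setOf_eq] at hwS; tauto
      have hj : j = i := by
        rcases hw' with rfl | rfl
        · exact ((hm i _ 2 (by simp)).1 hw).1
        · exact ((hm i _ 3 (by simp)).1 hw).1
      have e1 := hu (i, 2) ((hm i _ 2 (by simp)).2 ⟨hj, by simp; tauto⟩) (by simp)
      have e2 := hu (i, 3) ((hm i _ 3 (by simp)).2 ⟨hj, by simp; tauto⟩) (by simp)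
      rw [← e1] at e2
      simp at e2
  have h2 : ∀ i : Fin k, 2 ≤ (S.toFinset.filter (fun p => p.1 = i)).card := by
    intro i
    have : ∃ m, (m = 2 ∨ m = 3) ∧ (i, m) ∈ S := by
      rcases h1 i with h | h
      · exact ⟨2, by simp, h⟩
      · exact ⟨3, by simp, h⟩
    obtain ⟨m, hm', hmS⟩ := this
    obtain ⟨w, hw, ha⟩ := hS.2 _ hmS
    have := ((hm i w m hm').1 ha.symm).1
    rw [← Finset.card_pair ha.ne]
    apply Finset.card_le_card
    intro p hp
    simp only [Finset.mem_insert, Finset.mem_singleton] at hp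
    rcases hp with rfl | rfl
    · simp [hmS]
    · simp [hw, this]
  have h3 := Finset.card_eq_sum_card_fiberwise (s := S.toFinset) (t := (Finset.univ : Finset (Fin k))) (f := fun p => p.1) (by intro p _; simp)
  have h4 : ∑ i : Fin k, 2 ≤ ∑ i : Fin k, (S.toFinset.filter (fun p => p.1 = i)).card :=
    Finset.sum_le_sum (fun i _ => h2 i)
  rw [Set.ncard_eq_toFinset_card']
  simp at h4
  omega

lemma Dia.key {a b c d a' b' : V} (h : Dia G a b c d a' b') {v w : V} (h1 : G.Adj a v)
    (h2 : G.Adj v w) (h3 : G.Adj a w) : v = c ∨ v = d := by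
  rcases (h.ha.adj v).1 h1 with rfl | rfl | rfl
  · simp
  · simp
  · exfalso
    rcases (h.ha.adj w).1 h3 with rfl | rfl | rfl
    · rcases (h.hc.adj _).1 h2.symm with e | e | e
      · exact h1.ne e.symm
      · exact h.nab (e ▸ h1)
      · exact h.ha.qr e.symm
    · rcases (h.hd.adj _).1 h2.symm with e | e | e
      · exact h1.ne e.symm
      · exact h.nab (e ▸ h1)
      · exact h.ha.pr e.symm
    · exact h2.ne rfl

lemma Dia.not_mid {a b c d a' b' e g h e' g' : V} (h1 : Dia G a b c d a' b')
    (h2 : Dia G e g a h e' g') : False := by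
  have ae : G.Adj a e := by simp [h2.hc.adj]
  have ag : G.Adj a g := by simp [h2.hc.adj]
  have ah : G.Adj a h := by simp [h2.hc.adj]
  have eh : G.Adj e h := by simp [h2.ha.adj]
  have gh : G.Adj g h := by simp [h2.hb.adj]
  have k1 := h1.key ae eh ah
  have k2 := h1.key ag gh ah
  have k3 := h1.key ah gh.symm ag
  have := h2.hc.pq; have := h2.hc.pr; have := h2.hc.qr
  grind

lemma Dia.uniq {a b c d a' b' b2 c2 d2 a2 b2' : V} (h1 : Dia G a b c d a' b')
    (h2 : Dia G a b2 c2 d2 a2 b2') : b = b2 ∧ a' = a2 := by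
  have hc : G.Adj a c2 := by simp [h2.ha.adj]
  have hd : G.Adj a d2 := by simp [h2.ha.adj]
  have ha : G.Adj a a2 := by simp [h2.ha.adj]
  have cd : G.Adj c2 d2 := by simp [h2.hc.adj]
  have cb : G.Adj c2 b2 := by simp [h2.hc.adj]
  have k1 := h1.key hc cd hd
  have k2 := h1.key hd cd.symm hc
  have k3 := (h1.ha.adj a2).1 ha
  have e1 := h2.ha.pq; have e2 := h2.ha.pr; have e3 := h2.ha.qr
  have e4 := h2.hc.pq; have e5 := h2.hc.qr
  have e6 := h1.hc.adj b2
  have e7 := h1.hd.adj b2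
  grind

lemma necklace_abs (hconn : G.Connected) {k : ℕ} (hk : 0 < k)
    (A B C D : Fin k → V) (s : Fin k → Fin k) (hs : ∀ i, (s i : ℕ) = ((i : ℕ) + 1) % k)
    (hA : ∀ i w, G.Adj (A i) w ↔ w = C i ∨ w = D i ∨ w = B (s i))
    (hB : ∀ i, ∃ l, ∀ w, G.Adj (B i) w ↔ w = C i ∨ w = D i ∨ w = A l)
    (hC : ∀ i w, G.Adj (C i) w ↔ w = B i ∨ w = A i ∨ w = D i)
    (hD : ∀ i w, G.Adj (D i) w ↔ w = B i ∨ w = A i ∨ w = C i)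
    (iA : ∀ i j, A i = A j ↔ i = j) (iB : ∀ i j, B i = B j ↔ i = j)
    (iC : ∀ i j, C i = C j ↔ i = j) (iD : ∀ i j, D i = D j ↔ i = j)
    (AB : ∀ i j, A i ≠ B j) (AC : ∀ i j, A i ≠ C j) (AD : ∀ i j, A i ≠ D j)
    (BC : ∀ i j, B i ≠ C j) (BD : ∀ i j, B i ≠ D j) (CD : ∀ i j, C i ≠ D j) :
    Nonempty (G ≃g diamondNecklace k) := by
  have : Nonempty (Fin k × Fin 4) := ⟨(⟨0, hk⟩, 0)⟩
  have BA := fun i j => (AB j i).symm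
  have CA := fun i j => (AC j i).symm
  have DA := fun i j => (AD j i).symm
  have CB := fun i j => (BC j i).symm
  have DB := fun i j => (BD j i).symm
  have DC := fun i j => (CD j i).symm
  have hs' : ∀ i j : Fin k, (j : ℕ) = ((i : ℕ) + 1) % k ↔ j = s i := by
    intro i j
    rw [← hs, Fin.ext_iff]
  have hle : ∀ i j (m n : Fin 4), m ≤ n →
      (G.Adj (![A i, B i, C i, D i] m) (![A j, B j, C j, D j] n) ↔
        (diamondNecklace k).Adj (i, m) (j, n)) := by
    intro i j m n hmn
    obtain ⟨l, hl⟩ := hB i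
    have e : i = j ↔ j = i := eq_comm
    simp only [diamondNecklace, SimpleGraph.fromRel_adj, hs']
    fin_cases m <;> fin_cases n <;> first
      | (exfalso; revert hmn; decide)
      | (simp [hA, hl, hC, hD, iA, iB, iC, iD, AB, AC, AD, BC, BD, CD, BA, CA, DA, CB, DB, DC, e])
  refine isoOf _ hconn (fun p : Fin k × Fin 4 => ![A p.1, B p.1, C p.1, D p.1] p.2) ?_ ?_ ?_
  · rintro ⟨i, m⟩ ⟨j, n⟩ h
    fin_cases m <;> fin_cases n <;>
      simp [iA, iB, iC, iD, AB, AC, AD, BC, BD, CD, BA, CA, DA, CB, DB, DC] at h ⊢ <;> exact h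
  · rintro ⟨i, m⟩ ⟨j, n⟩
    rcases le_total m n with h | h
    · exact hle i j m n h
    · rw [G.adj_comm, (diamondNecklace k).adj_comm]
      exact hle j i n m h
  · rintro ⟨i, m⟩ w hw
    obtain ⟨l, hl⟩ := hB i
    have : w = A i ∨ w = B i ∨ w = C i ∨ w = D i ∨ w = A l ∨ w = B (s i) := by
      fin_cases m <;> simp [hA, hl, hC, hD] at hw <;> tauto
    rcases this with rfl | rfl | rfl | rfl | rfl | rfl
    · exact ⟨(i, 0), rfl⟩
    · exact ⟨(i, 1), rfl⟩
    · exact ⟨(i, 2), rfl⟩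
    · exact ⟨(i, 3), rfl⟩
    · exact ⟨(l, 0), rfl⟩
    · exact ⟨(s i, 1), rfl⟩

lemma necklace_case (hconn : G.Connected) (hall : ∀ v, InDia G v) :
    ∃ k : ℕ, 2 ≤ k ∧ Nonempty (G ≃g diamondNecklace k) := by
  let E := {v : V // ∃ b c d a' b', Dia G v b c d a' b'}
  have hE : ∀ e : E, ∃ b c d a' b', Dia G e.1 b c d a' b' := fun e => e.2
  choose o c d ot f hD using hE
  have hf : ∀ e, ∃ b' c' d' f', Dia G (f e) b' c' d' (o e) f' := by
    intro e
    have h := (hD e).swapE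
    have ho := h.outA
    exact Dia.entry h.tc (u := o e) (by simp) (by simp; tauto) (by simp [h.ha.adj]) (hall _)
  let F : E → E := fun e => ⟨f e, by
    obtain ⟨b', c', d', f', h⟩ := hf e
    exact ⟨b', c', d', _, f', h⟩⟩
  let O : E → E := fun e => ⟨o e, _, _, _, _, _, (hD e).swapE⟩
  have hotF : ∀ e, ot (F e) = o e := by
    intro e
    obtain ⟨b', c', d', f', h⟩ := hf e
    exact ((hD (F e)).uniq h).2
  have hOO : ∀ e, O (O e) = e := by
    intro e
    apply Subtype.ext
    exact ((hD (O e)).uniq (hD e).swapE).1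
  have hfO : ∀ e, f (O e) = ot e := by
    intro e
    have h1 := (hD (O e)).swapE
    have h2 : o (O e) = e.1 := congrArg Subtype.val (hOO e)
    rw [h2] at h1
    exact (h1.uniq (hD e)).2
  have hFOF : ∀ e, F (O (F e)) = O e := by
    intro e
    apply Subtype.ext
    exact (hfO (F e)).trans (hotF e)
  have hOinj : Function.Injective O := Function.LeftInverse.injective hOO
  have hFinj : Function.Injective F := by
    intro e1 e2 h
    apply hOinj
    apply Subtype.ext
    change o e1 = o e2
    rw [← hotF, ← hotF, h]
  have hOne : ∀ e, e ≠ O e := fun e h => (hD e).hc.pq (congrArg Subtype.val h)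
  have hFne : ∀ e, F e ≠ O e := fun e h => (hD e).swapE.outA.1 (congrArg Subtype.val h)
  have orient : ∀ n e, F^[n] e ≠ O e := by
    intro n
    induction n using Nat.strong_induction_on with
    | _ n ih =>
    intro e
    match n, ih with
    | 0, _ => exact hOne e
    | 1, _ => exact hFne e
    | n + 2, ih =>
      intro h
      rw [Function.iterate_succ_apply', ← hFOF e] at h
      have := hFinj h
      rw [Function.iterate_succ_apply] at this
      exact ih n (by omega) _ this
  have orient2 : ∀ i j e, F^[i] e ≠ O (F^[j] e) := by
    intro i j e h
    rcases le_total j i with hij | hij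
    · obtain ⟨n, rfl⟩ := Nat.exists_eq_add_of_le' hij
      rw [Function.iterate_add_apply] at h
      exact orient _ _ h
    · obtain ⟨n, rfl⟩ := Nat.exists_eq_add_of_le' hij
      have h' := congrArg O h
      rw [hOO, Function.iterate_add_apply] at h'
      exact orient _ _ h'.symm
  obtain ⟨v0⟩ := hconn.nonempty
  obtain ⟨a0, b0, c0, d0, a0', b0', h0, -⟩ := hall v0
  let e0 : E := ⟨a0, b0, c0, d0, a0', b0', h0⟩
  have hper : e0 ∈ Function.periodicPts F := hFinj.mem_periodicPts e0
  set k := Function.minimalPeriod F e0 with hk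
  have hkpos : 0 < k := Function.minimalPeriod_pos_of_mem_periodicPts hper
  have hk2 : 2 ≤ k := by
    by_contra hlt
    have hk1 : k = 1 := by omega
    have hfix : F e0 = e0 := by
      have := Function.iterate_minimalPeriod (f := F) (x := e0)
      rw [← hk, hk1] at this
      simpa using this
    have h1 := hotF e0
    rw [hfix] at h1
    exact (hD e0).outA.2.1 h1
  refine ⟨k, hk2, ?_⟩
  let B : Fin k → E := fun i => F^[(i : ℕ)] e0
  let s : Fin k → Fin k := fun i => ⟨((i : ℕ) + 1) % k, Nat.mod_lt _ hkpos⟩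
  have hBs : ∀ i, B (s i) = F (B i) := by
    intro i
    change F^[((i : ℕ) + 1) % k] e0 = _
    have h1 : F^[((i : ℕ) + 1) % k] e0 = F^[(i : ℕ) + 1] e0 :=
      Function.iterate_mod_minimalPeriod_eq
    rw [h1, Function.iterate_succ_apply']
  have hBinj : Function.Injective B := by
    intro i j h
    apply Fin.ext
    exact Function.iterate_injOn_Iio_minimalPeriod (f := F) (x := e0) i.2 j.2 h
  have hpred : ∀ i, ∃ j, s j = i := by
    intro i
    have : Function.Injective s := by
      intro i j h
      apply hBinj
      apply hFinj
      rw [← hBs, ← hBs, h]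
    exact Finite.surjective_of_injective this i
  have hot : ∀ i, ∃ j, s j = i ∧ ot (B i) = o (B j) := by
    intro i
    obtain ⟨j, rfl⟩ := hpred i
    exact ⟨j, rfl, by rw [hBs, hotF]⟩
  -- disjointness facts
  have fBO : ∀ i j, (B i).1 ≠ o (B j) := fun i j h => orient2 i j e0 (Subtype.ext h)
  have fB : ∀ i j, (B i).1 = (B j).1 → i = j := fun i j h => hBinj (Subtype.ext h)
  have fO : ∀ i j, o (B i) = o (B j) → i = j := fun i j h => hBinj (hOinj (Subtype.ext h))
  have fcE : ∀ (e e' : E), c e ≠ e'.1 := fun e e' h => by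
    have := hD e'
    rw [← h] at this
    exact this.not_mid (hD e)
  have fdE : ∀ (e e' : E), d e ≠ e'.1 := fun e e' h => by
    have := hD e'
    rw [← h] at this
    exact this.not_mid (hD e).swapM
  have fcO : ∀ (e e' : E), c e ≠ o e' := fun e e' => fcE e (O e')
  have fdO : ∀ (e e' : E), d e ≠ o e' := fun e e' => fdE e (O e')
  have fcd : ∀ i j, (c (B i) = c (B j) ∨ c (B i) = d (B j) ∨ d (B i) = d (B j)) → i = j := by
    intro i j h
    have h1 : G.Adj (c (B i)) (B i).1 := by simp [(hD (B i)).hc.adj]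
    have h2 : G.Adj (d (B i)) (B i).1 := by simp [(hD (B i)).hd.adj]
    have h3 : (B i).1 = (B j).1 ∨ (B i).1 = o (B j) ∨ (B i).1 = d (B j) ∨ (B i).1 = c (B j) := by
      rcases h with h | h | h
      · rw [h, (hD (B j)).hc.adj] at h1; tauto
      · rw [h, (hD (B j)).hd.adj] at h1; tauto
      · rw [h, (hD (B j)).hd.adj] at h2; tauto
    rcases h3 with h3 | h3 | h3 | h3
    · exact fB i j h3
    · exact absurd h3 (fBO i j)
    · exact absurd h3.symm (fdE _ _)
    · exact absurd h3.symm (fcE _ _)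
  have fcdne : ∀ i j, c (B i) ≠ d (B j) := by
    intro i j h
    have := fcd i j (by tauto)
    subst this
    exact (hD (B i)).ha.pq h
  refine necklace_abs hconn hkpos (fun i => o (B i)) (fun i => (B i).1) (fun i => c (B i))
    (fun i => d (B i)) s (fun i => rfl) ?_ ?_ ?_ ?_ ?_ ?_ ?_ ?_ ?_ ?_ ?_ ?_ ?_ ?_
  · intro i w
    have hfB : f (B i) = (B (s i)).1 := by rw [hBs]
    have := (hD (B i)).hb.adj w
    rw [hfB] at this
    exact this
  · intro i
    obtain ⟨l, -, hl⟩ := hot i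
    have := (hD (B i)).ha.adj
    rw [hl] at this
    exact ⟨l, this⟩
  · exact fun i => (hD (B i)).hc.adj
  · exact fun i => (hD (B i)).hd.adj
  · exact fun i j => ⟨fO i j, fun h => by rw [h]⟩
  · exact fun i j => ⟨fB i j, fun h => by rw [h]⟩
  · exact fun i j => ⟨fun h => fcd i j (.inl h), fun h => by rw [h]⟩
  · exact fun i j => ⟨fun h => fcd i j (.inr (.inr h)), fun h => by rw [h]⟩
  · exact fun i j h => fBO j i h.symm
  · exact fun i j h => fcO _ _ h.symm
  · exact fun i j h => fdO _ _ h.symm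
  · exact fun i j h => fcE _ _ h.symm
  · exact fun i j h => fdE _ _ h.symm
  · exact fcdne

lemma trichotomy (hconn : G.Connected) (hcf : ClawFree G) (hc : IsCubic G) (hK : NoK4 G) :
    (∃ S' : Finset V, IsTotalForcingSet G (S' : Set V) ∧ 2 * S'.card < Fintype.card V) ∨
    ((∃ S' : Finset V, IsTotalForcingSet G (S' : Set V) ∧ 2 * S'.card ≤ Fintype.card V) ∧
      ((∃ k : ℕ, 2 ≤ k ∧ Nonempty (G ≃g diamondNecklace k)) ∨ Nonempty (G ≃g prism))) := by
  have fin : JJ G → ∃ S' : Finset V, IsTotalForcingSet G (S' : Set V) ∧ 2 * S'.card < Fintype.card V := by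
    rintro ⟨S, T, h, hJ⟩
    exact finish hconn hcf hc hK _ rfl h hJ
  by_cases hD : ∃ v, InDia G v
  · rcases startD hconn hcf hc hK hD with h | ⟨h1, h2⟩
    · exact .inl (fin h)
    · exact .inr ⟨h2, .inl (necklace_case hconn h1)⟩
  · push Not at hD
    rcases startNoD hconn hcf hc hK hD with h | ⟨x, y, z, x', y', z', h1, h2⟩
    · exact .inl (fin h)
    · have := prism_case hconn hc hK h1 h2
      exact .inr ⟨this.1, .inr this.2⟩

end Fin

end Aux

/-- If `G ≠ K₄` is a connected, claw-free, cubic graph of order `n`, then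
`F_t(G) = n/2` if and only if `G` is a diamond-necklace `N_k` (`k ≥ 2`) or the prism
`C₃ □ K₂`. -/
theorem totalForcingNumber_eq_half_iff {V : Type*} [Fintype V]
    (G : SimpleGraph V) (hconn : G.Connected) (hcf : ClawFree G) (hcubic : IsCubic G)
    (hK4 : ¬ Nonempty (G ≃g (⊤ : SimpleGraph (Fin 4)))) :
    2 * totalForcingNumber G = Fintype.card V ↔
      ((∃ k : ℕ, 2 ≤ k ∧ Nonempty (G ≃g diamondNecklace k)) ∨ Nonempty (G ≃g prism)) := by
  classical
  have hK := noK4 hconn hcubic hK4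
  have htri := trichotomy hconn hcf hcubic hK
  have upper : ∀ S : Finset V, IsTotalForcingSet G (S : Set V) → totalForcingNumber G ≤ S.card :=
    fun S hS => Nat.sInf_le ⟨S, hS, Set.ncard_coe_finset S⟩
  constructor
  · intro h
    rcases htri with ⟨S, hS, hlt⟩ | ⟨-, h2⟩
    · have := upper S hS
      omega
    · exact h2
  · intro h
    have hex : ∃ S : Finset V, IsTotalForcingSet G (S : Set V) ∧ 2 * S.card ≤ Fintype.card V := by
      rcases htri with ⟨S, hS, hlt⟩ | ⟨h1, -⟩
      · exact ⟨S, hS, hlt.le⟩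
      · exact h1
    obtain ⟨S, hS, hle⟩ := hex
    have h1 := upper S hS
    obtain ⟨R, hR, hRn⟩ : ∃ R : Set V, IsTotalForcingSet G R ∧ R.ncard = totalForcingNumber G :=
      Nat.sInf_mem (s := {n : ℕ | ∃ S : Set V, IsTotalForcingSet G S ∧ S.ncard = n})
        ⟨_, S, hS, rfl⟩
    have lower : Fintype.card V ≤ 2 * R.ncard := by
      rcases h with ⟨k, -, ⟨e⟩⟩ | ⟨⟨e⟩⟩
      · have h2 := necklace_lower k _ (hR.map e)
        rw [Set.ncard_image_of_injective _ e.injective] at h2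
        rw [Fintype.card_congr e.toEquiv]
        simp
        omega
      · have h2 := three_le hcubic hconn.nonempty R.toFinset (by simpa using hR)
        rw [← Set.ncard_eq_toFinset_card'] at h2
        rw [Fintype.card_congr e.toEquiv]
        simp
        omega
    omega
end
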